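/- Estimate of the vertical transport term I₂: there exists a constant C > 0 depending only on τ₀ such that, under the standing assumptions, ∑_{n≥0} ∑_{|α|=n} |I^α_2| τⁿ Mₙ / ‖θ ⟨r⟩ⁿ ∂^α_h g‖_{L²} ≤ C τ^{−2} ⟨t⟩^{1/4} ( ‖g‖_{X_τ} + ‖g‖_{Y_τ} ) ‖g‖_{D_τ}. -/

import Mathlib

open MeasureTheory Filter Set

noncomputable section

/-- `⟨t⟩ = 1 + t` -/
def angT (t : ℝ) : ℝ := 1 + t

/-- `θ_λ(z) = exp (λ z² / (8⟨t⟩))`; `θ = θ₁`. -/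
def thw (t lam z : ℝ) : ℝ := Real.exp (lam * z ^ 2 / (8 * angT t))

/-- `⟨r⟩ = √(x² + y² + 1)` -/
def angR (x y : ℝ) : ℝ := Real.sqrt (x ^ 2 + y ^ 2 + 1)

/-- `Mₙ = (n+1)⁴ / n!` -/
def Mfac (n : ℕ) : ℝ := ((n : ℝ) + 1) ^ 4 / (n.factorial : ℝ)

/-- `∂_x` -/
def pdx (f : ℝ → ℝ → ℝ → ℝ) : ℝ → ℝ → ℝ → ℝ := fun x y z => deriv (fun x' => f x' y z) x
/-- `∂_y` -/
def pdy (f : ℝ → ℝ → ℝ → ℝ) : ℝ → ℝ → ℝ → ℝ := fun x y z => deriv (fun y' => f x y' z) y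
/-- `∂_z` -/
def pdz (f : ℝ → ℝ → ℝ → ℝ) : ℝ → ℝ → ℝ → ℝ := fun x y z => deriv (fun z' => f x y z') z

/-- `∂^α_h = ∂_x^{α₁} ∂_y^{α₂}` for the multi-index `α = (a, b)` -/
def pdh (a b : ℕ) (f : ℝ → ℝ → ℝ → ℝ) : ℝ → ℝ → ℝ → ℝ := pdx^[a] (pdy^[b] f)

/-- `r ∂_r = x ∂_x + y ∂_y` -/
def rdr (f : ℝ → ℝ → ℝ → ℝ) : ℝ → ℝ → ℝ → ℝ := fun x y z => x * pdx f x y z + y * pdy f x y z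

/-- weighted `L²` norm over `ℝ² × (0,∞)` of `θ_λ ⟨r⟩ⁿ f` -/
def L2w (t lam : ℝ) (n : ℕ) (f : ℝ → ℝ → ℝ → ℝ) : ℝ :=
  Real.sqrt (∫ x : ℝ, ∫ y : ℝ, ∫ z in Ioi (0 : ℝ), (thw t lam z * angR x y ^ n * f x y z) ^ 2)

/-- weighted `L²_z` norm at fixed `(x, y)` of `θ_λ ⟨r⟩ⁿ f (x, y, ·)` -/
def L2z (t lam : ℝ) (n : ℕ) (f : ℝ → ℝ → ℝ → ℝ) (x y : ℝ) : ℝ :=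
  Real.sqrt (∫ z in Ioi (0 : ℝ), (thw t lam z * angR x y ^ n * f x y z) ^ 2)

/-- mixed `L^∞_h L²_z` norm of `θ_λ ⟨r⟩ⁿ f` -/
def LIh2z (t lam : ℝ) (n : ℕ) (f : ℝ → ℝ → ℝ → ℝ) : ℝ :=
  Real.sqrt (∫ z in Ioi (0 : ℝ), (⨆ p : ℝ × ℝ, |thw t lam z * angR p.1 p.2 ^ n * f p.1 p.2 z|) ^ 2)

/-- mixed `L²_h L^∞_z` norm of `θ_λ ⟨r⟩ⁿ f` -/
def L2hIz (t lam : ℝ) (n : ℕ) (f : ℝ → ℝ → ℝ → ℝ) : ℝ :=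
  Real.sqrt (∫ x : ℝ, ∫ y : ℝ,
    (⨆ z : Ioi (0 : ℝ), |thw t lam (z : ℝ) * angR x y ^ n * f x y (z : ℝ)|) ^ 2)

/-- the primitive `φ(x,y,z) = exp(−z²/(4⟨t⟩)) ∫₀^z g(x,y,s) exp(s²/(4⟨t⟩)) ds` -/
def phiF (t : ℝ) (g : ℝ → ℝ → ℝ → ℝ) : ℝ → ℝ → ℝ → ℝ := fun x y z =>
  Real.exp (-(z ^ 2) / (4 * angT t)) * ∫ s in (0 : ℝ)..z, g x y s * Real.exp (s ^ 2 / (4 * angT t))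

/-- `u^r = ∂_z φ` -/
def ur (t : ℝ) (g : ℝ → ℝ → ℝ → ℝ) : ℝ → ℝ → ℝ → ℝ := pdz (phiF t g)

/-- `u^z = −(x∂_x + y∂_y)φ − 2φ` -/
def uzv (t : ℝ) (g : ℝ → ℝ → ℝ → ℝ) : ℝ → ℝ → ℝ → ℝ := fun x y z =>
  -(rdr (phiF t g) x y z) - 2 * phiF t g x y z

/-- smoothness together with rapid decay in `z` of all derivatives -/
def DecaySmooth (g : ℝ → ℝ → ℝ → ℝ) : Prop :=
  ContDiff ℝ (⊤ : ℕ∞) (fun p : ℝ × ℝ × ℝ => g p.1 p.2.1 p.2.2) ∧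
  ∀ a b k m : ℕ, ∀ x y : ℝ,
    Tendsto (fun z : ℝ => z ^ m * pdz^[k] (pdh a b g) x y z) atTop (nhds 0)

/-- `θ ⟨r⟩^{|α|} ∂^α_h g ∈ L²(ℝ² × (0,∞))` for every `α` -/
def L2cond (t : ℝ) (g : ℝ → ℝ → ℝ → ℝ) : Prop :=
  ∀ a b : ℕ,
    Integrable
      (fun p : ℝ × ℝ × ℝ =>
        (thw t 1 p.2.2 * angR p.1 p.2.1 ^ (a + b) * pdh a b g p.1 p.2.1 p.2.2) ^ 2)
      (volume.restrict {p : ℝ × ℝ × ℝ | 0 < p.2.2})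

/-- `θ ⟨r⟩^{|α|} ∂^α_h ∂_z g ∈ L²(ℝ² × (0,∞))` for every `α` -/
def L2condZ (t : ℝ) (g : ℝ → ℝ → ℝ → ℝ) : Prop :=
  ∀ a b : ℕ,
    Integrable
      (fun p : ℝ × ℝ × ℝ =>
        (thw t 1 p.2.2 * angR p.1 p.2.1 ^ (a + b) * pdh a b (pdz g) p.1 p.2.1 p.2.2) ^ 2)
      (volume.restrict {p : ℝ × ℝ × ℝ | 0 < p.2.2})

/-- `X_n(g, τ)` -/
def Xel (t τ : ℝ) (g : ℝ → ℝ → ℝ → ℝ) (n : ℕ) : ℝ :=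
  (∑ a ∈ Finset.range (n + 1), L2w t 1 n (pdh a (n - a) g)) * τ ^ n * Mfac n

/-- `D_n(g, τ) = X_n(∂_z g, τ)` -/
def Del (t τ : ℝ) (g : ℝ → ℝ → ℝ → ℝ) (n : ℕ) : ℝ :=
  (∑ a ∈ Finset.range (n + 1), L2w t 1 n (pdh a (n - a) (pdz g))) * τ ^ n * Mfac n

/-- `Y_n(g, τ)` (with `Y₀ = 0`) -/
def Yel (t τ : ℝ) (g : ℝ → ℝ → ℝ → ℝ) (n : ℕ) : ℝ :=
  (∑ a ∈ Finset.range (n + 1), L2w t 1 n (pdh a (n - a) g)) * τ ^ (n - 1) * (n : ℝ) * Mfac n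

/-- `‖g‖_{X_τ}` -/
def Xnrm (t τ : ℝ) (g : ℝ → ℝ → ℝ → ℝ) : ℝ := ∑' n : ℕ, Xel t τ g n
/-- `‖g‖_{D_τ}` -/
def Dnrm (t τ : ℝ) (g : ℝ → ℝ → ℝ → ℝ) : ℝ := ∑' n : ℕ, Del t τ g n
/-- `‖g‖_{Y_τ}` -/
def Ynrm (t τ : ℝ) (g : ℝ → ℝ → ℝ → ℝ) : ℝ := ∑' n : ℕ, Yel t τ g n

/-- triple integral over `ℝ² × (0,∞)` -/
def trip (F : ℝ → ℝ → ℝ → ℝ) : ℝ := ∫ x : ℝ, ∫ y : ℝ, ∫ z in Ioi (0 : ℝ), F x y z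

/-- `I^α_1` -/
def I1 (t : ℝ) (g : ℝ → ℝ → ℝ → ℝ) (a b : ℕ) : ℝ :=
  -trip fun x y z =>
    thw t 2 z * angR x y ^ (2 * (a + b)) *
      pdh a b (fun x' y' z' => ur t g x' y' z' * rdr g x' y' z') x y z * pdh a b g x y z

/-- `I^α_2` -/
def I2 (t : ℝ) (g : ℝ → ℝ → ℝ → ℝ) (a b : ℕ) : ℝ :=
  -trip fun x y z =>
    thw t 2 z * angR x y ^ (2 * (a + b)) *
      pdh a b (fun x' y' z' => uzv t g x' y' z' * pdz g x' y' z') x y z * pdh a b g x y z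

/-- `I^α_3` -/
def I3 (t : ℝ) (g : ℝ → ℝ → ℝ → ℝ) (a b : ℕ) : ℝ :=
  -trip fun x y z =>
    thw t 2 z * angR x y ^ (2 * (a + b)) *
      pdh a b (fun x' y' z' => ur t g x' y' z' ^ 2) x y z * pdh a b g x y z

/-- `I^α_4` -/
def I4 (t : ℝ) (g : ℝ → ℝ → ℝ → ℝ) (a b : ℕ) : ℝ :=
  (1 / (2 * angT t)) * trip fun x y z =>
    thw t 2 z * angR x y ^ (2 * (a + b)) *
      pdh a b
        (fun x' y' z' =>
          uzv t g x' y' z' * pdz (fun x'' y'' w => w * phiF t g x'' y'' w) x' y' z') x y z *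
      pdh a b g x y z

/-- `I^α_5` -/
def I5 (t : ℝ) (g : ℝ → ℝ → ℝ → ℝ) (a b : ℕ) : ℝ :=
  -(1 / angT t) * trip fun x y z =>
    z * thw t 2 z * angR x y ^ (2 * (a + b)) *
      pdh a b (fun x' y' z' => ur t g x' y' z' * phiF t g x' y' z') x y z * pdh a b g x y z

/-- `I^α_6` -/
def I6 (t : ℝ) (g : ℝ → ℝ → ℝ → ℝ) (a b : ℕ) : ℝ :=
  -(1 / (2 * angT t)) * trip fun x y z =>
    z * thw t 2 z * angR x y ^ (2 * (a + b)) *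
      (∫ s in Ioi z, pdh a b (fun x' y' z' => ur t g x' y' z' ^ 2) x y s) * pdh a b g x y z

/-- `I^α_7` -/
def I7 (t : ℝ) (g : ℝ → ℝ → ℝ → ℝ) (a b : ℕ) : ℝ :=
  (1 / angT t) * trip fun x y z =>
    z * thw t 2 z * angR x y ^ (2 * (a + b)) *
      (∫ s in Ioi z, pdh a b (fun x' y' z' => pdz (ur t g) x' y' z' * uzv t g x' y' z') x y s) *
      pdh a b g x y z

/-- `∑_{|α| = n} |I^α| τⁿ Mₙ / ‖θ ⟨r⟩ⁿ ∂^α_h g‖_{L²}` (with the convention `x / 0 = 0`) -/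
def Qterm (t τ : ℝ) (g : ℝ → ℝ → ℝ → ℝ) (I : ℕ → ℕ → ℝ) (n : ℕ) : ℝ :=
  ∑ a ∈ Finset.range (n + 1), |I a (n - a)| * τ ^ n * Mfac n / L2w t 1 n (pdh a (n - a) g)

/-- `∂_t` -/
def pdt (G : ℝ → ℝ → ℝ → ℝ → ℝ) (t x y z : ℝ) : ℝ := deriv (fun t' => G t' x y z) t

/-- the good-unknown axially symmetric Prandtl equation at the point `(t, x, y, z)` -/
def GoodEq (G : ℝ → ℝ → ℝ → ℝ → ℝ) (t x y z : ℝ) : Prop :=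
  pdt G t x y z
      + ur t (G t) x y z * rdr (G t) x y z
      + uzv t (G t) x y z * pdz (G t) x y z
      - pdz (pdz (G t)) x y z
      + G t x y z / angT t
      + ur t (G t) x y z ^ 2
      - 1 / (2 * angT t) * (uzv t (G t) x y z * pdz (fun x' y' w => w * phiF t (G t) x' y' w) x y z)
      + z / angT t * (ur t (G t) x y z * phiF t (G t) x y z)
      + z / (2 * angT t) * (∫ s in Ioi z, ur t (G t) x y s ^ 2)
      - z / angT t * (∫ s in Ioi z, pdz (ur t (G t)) x y s * uzv t (G t) x y s) = 0

/-- Joint continuity of a curried function of three real variables. -/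
def JCont (f : ℝ → ℝ → ℝ → ℝ) : Prop := Continuous fun p : ℝ × ℝ × ℝ => f p.1 p.2.1 p.2.2

/-- Joint smoothness of a curried function of three real variables. -/
def Smooth3 (f : ℝ → ℝ → ℝ → ℝ) : Prop :=
  ContDiff ℝ (⊤ : ℕ∞) fun p : ℝ × ℝ × ℝ => f p.1 p.2.1 p.2.2

/-- `U i j` is a jointly continuous `∂_x^i ∂_y^j`-derivative of `U 0 0`. -/
structure IsTower (U : ℕ → ℕ → ℝ → ℝ → ℝ → ℝ) : Prop where
  cont : ∀ i j, JCont (U i j)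
  dx : ∀ i j x y z, HasDerivAt (fun s => U i j s y z) (U (i + 1) j x y z) x
  dy : ∀ i j x y z, HasDerivAt (fun s => U i j x s z) (U i (j + 1) x y z) y

theorem JCont.comp {f : ℝ → ℝ → ℝ → ℝ} (hf : JCont f) {X : Type*} [TopologicalSpace X]
    {a b c : X → ℝ} (ha : Continuous a) (hb : Continuous b) (hc : Continuous c) :
    Continuous fun p => f (a p) (b p) (c p) :=
  Continuous.comp (g := fun p : ℝ × ℝ × ℝ => f p.1 p.2.1 p.2.2) hf
    (ha.prodMk (hb.prodMk hc))

theorem Smooth3.jcont {f : ℝ → ℝ → ℝ → ℝ} (hf : Smooth3 f) : JCont f := ContDiff.continuous hf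

theorem IsTower.pdh_eq {U : ℕ → ℕ → ℝ → ℝ → ℝ → ℝ} (hU : IsTower U) (a b : ℕ) :
    pdh a b (U 0 0) = U a b := by
  have hy : ∀ b, pdy^[b] (U 0 0) = U 0 b := by
    intro b
    induction b with
    | zero => rfl
    | succ b ih =>
      rw [Function.iterate_succ_apply', ih]
      funext x y z
      exact (hU.dy 0 b x y z).deriv
  unfold pdh
  rw [hy]
  induction a with
  | zero => rfl
  | succ a ih =>
    rw [Function.iterate_succ_apply', ih]
    funext x y z
    exact (hU.dx a b x y z).deriv

theorem Smooth3.hasDerivAt_x {f : ℝ → ℝ → ℝ → ℝ} (hf : Smooth3 f) (x y z : ℝ) :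
    HasDerivAt (fun s => f s y z)
      (fderiv ℝ (fun p : ℝ × ℝ × ℝ => f p.1 p.2.1 p.2.2) (x, y, z) (1, 0, 0)) x := by
  have h := (ContDiff.differentiable hf (by simp) (x, y, z)).hasFDerivAt
  exact h.comp_hasDerivAt (f := fun s : ℝ => ((s, y, z) : ℝ × ℝ × ℝ)) x
    ((hasDerivAt_id x).prodMk (hasDerivAt_const x (y, z)))

theorem Smooth3.hasDerivAt_y {f : ℝ → ℝ → ℝ → ℝ} (hf : Smooth3 f) (x y z : ℝ) :
    HasDerivAt (fun s => f x s z)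
      (fderiv ℝ (fun p : ℝ × ℝ × ℝ => f p.1 p.2.1 p.2.2) (x, y, z) (0, 1, 0)) y := by
  have h := (ContDiff.differentiable hf (by simp) (x, y, z)).hasFDerivAt
  exact h.comp_hasDerivAt (f := fun s : ℝ => ((x, s, z) : ℝ × ℝ × ℝ)) y
    ((hasDerivAt_const y x).prodMk ((hasDerivAt_id y).prodMk (hasDerivAt_const y z)))

theorem Smooth3.hasDerivAt_z {f : ℝ → ℝ → ℝ → ℝ} (hf : Smooth3 f) (x y z : ℝ) :
    HasDerivAt (fun s => f x y s)
      (fderiv ℝ (fun p : ℝ × ℝ × ℝ => f p.1 p.2.1 p.2.2) (x, y, z) (0, 0, 1)) z := by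
  have h := (ContDiff.differentiable hf (by simp) (x, y, z)).hasFDerivAt
  exact h.comp_hasDerivAt (f := fun s : ℝ => ((x, y, s) : ℝ × ℝ × ℝ)) z
    ((hasDerivAt_const z x).prodMk ((hasDerivAt_const z y).prodMk (hasDerivAt_id z)))

theorem Smooth3.fderiv_apply {f : ℝ → ℝ → ℝ → ℝ} (hf : Smooth3 f) (v : ℝ × ℝ × ℝ) :
    ContDiff ℝ (⊤ : ℕ∞)
      fun p => fderiv ℝ (fun p : ℝ × ℝ × ℝ => f p.1 p.2.1 p.2.2) p v :=
  (ContDiff.fderiv_right (m := (⊤ : ℕ∞)) hf (by simp)).clm_apply contDiff_const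

theorem Smooth3.pdx {f : ℝ → ℝ → ℝ → ℝ} (hf : Smooth3 f) : Smooth3 (pdx f) := by
  have h := hf.fderiv_apply (1, 0, 0)
  have e := funext fun p : ℝ × ℝ × ℝ => (hf.hasDerivAt_x p.1 p.2.1 p.2.2).deriv
  exact (e.symm ▸ h :)

theorem Smooth3.pdy {f : ℝ → ℝ → ℝ → ℝ} (hf : Smooth3 f) : Smooth3 (pdy f) := by
  have h := hf.fderiv_apply (0, 1, 0)
  have e := funext fun p : ℝ × ℝ × ℝ => (hf.hasDerivAt_y p.1 p.2.1 p.2.2).deriv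
  exact (e.symm ▸ h :)

theorem Smooth3.pdz {f : ℝ → ℝ → ℝ → ℝ} (hf : Smooth3 f) : Smooth3 (pdz f) := by
  have h := hf.fderiv_apply (0, 0, 1)
  have e := funext fun p : ℝ × ℝ × ℝ => (hf.hasDerivAt_z p.1 p.2.1 p.2.2).deriv
  exact (e.symm ▸ h :)

theorem Smooth3.pdy_pdx {f : ℝ → ℝ → ℝ → ℝ} (hf : Smooth3 f) :
    _root_.pdy (_root_.pdx f) = _root_.pdx (_root_.pdy f) := by
  funext x y z
  set F := fun p : ℝ × ℝ × ℝ => f p.1 p.2.1 p.2.2 with hF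
  have hd : Differentiable ℝ (fderiv ℝ F) :=
    (ContDiff.fderiv_right (m := (⊤ : ℕ∞)) hf (by simp)).differentiable (by simp)
  have key : ∀ v w : ℝ × ℝ × ℝ, ∀ p,
      fderiv ℝ (fun q => fderiv ℝ F q v) p w = fderiv ℝ (fderiv ℝ F) p w v := by
    intro v w p
    rw [fderiv_clm_apply (hd p) (by fun_prop)]
    simp
  have hs : IsSymmSndFDerivAt ℝ F (x, y, z) :=
    ContDiffAt.isSymmSndFDerivAt (n := (⊤ : ℕ∞)) (ContDiff.contDiffAt hf)
      (by simp [minSmoothness_of_isRCLikeNormedField]; exact WithTop.coe_le_coe.2 le_top)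
  have ex : (fun p : ℝ × ℝ × ℝ => _root_.pdx f p.1 p.2.1 p.2.2) = fun p => fderiv ℝ F p (1, 0, 0) :=
    funext fun p => (hf.hasDerivAt_x p.1 p.2.1 p.2.2).deriv
  have ey : (fun p : ℝ × ℝ × ℝ => _root_.pdy f p.1 p.2.1 p.2.2) = fun p => fderiv ℝ F p (0, 1, 0) :=
    funext fun p => (hf.hasDerivAt_y p.1 p.2.1 p.2.2).deriv
  have h1 := (hf.pdx.hasDerivAt_y x y z).deriv
  have h2 := (hf.pdy.hasDerivAt_x x y z).deriv
  rw [ex, key] at h1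
  rw [ey, key] at h2
  exact h1.trans ((hs.eq _ _).trans h2.symm)

theorem Smooth3.iterate_pdx {f : ℝ → ℝ → ℝ → ℝ} (hf : Smooth3 f) (a : ℕ) :
    Smooth3 (_root_.pdx^[a] f) := by
  induction a with
  | zero => exact hf
  | succ a ih => rw [Function.iterate_succ_apply']; exact ih.pdx

theorem Smooth3.pdh {f : ℝ → ℝ → ℝ → ℝ} (hf : Smooth3 f) (a b : ℕ) : Smooth3 (pdh a b f) := by
  refine Smooth3.iterate_pdx ?_ a
  induction b with
  | zero => exact hf
  | succ b ih => rw [Function.iterate_succ_apply']; exact ih.pdy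

theorem Smooth3.pdy_pdh {f : ℝ → ℝ → ℝ → ℝ} (hf : Smooth3 f) (a b : ℕ) :
    _root_.pdy (_root_.pdh a b f) = _root_.pdh a (b + 1) f := by
  induction a with
  | zero => simp only [_root_.pdh, Function.iterate_zero, id, Function.iterate_succ_apply']
  | succ a ih =>
    have e : ∀ c, _root_.pdh (a + 1) c f = _root_.pdx (_root_.pdh a c f) := fun c => by
      simp only [_root_.pdh, Function.iterate_succ_apply']
    rw [e, e, (hf.pdh a b).pdy_pdx, ih]

theorem Smooth3.isTower {f : ℝ → ℝ → ℝ → ℝ} (hf : Smooth3 f) :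
    IsTower fun i j => _root_.pdh i j f where
  cont i j := (hf.pdh i j).jcont
  dx i j x y z := by
    have h := ((hf.pdh i j).hasDerivAt_x x y z).differentiableAt.hasDerivAt
    have e : _root_.pdh (i + 1) j f = _root_.pdx (_root_.pdh i j f) := by
      simp only [_root_.pdh, Function.iterate_succ_apply']
    rw [e]; exact h
  dy i j x y z := by
    have h := ((hf.pdh i j).hasDerivAt_y x y z).differentiableAt.hasDerivAt
    rw [← hf.pdy_pdh]; exact h

theorem JCont.integrand {f : ℝ → ℝ → ℝ → ℝ} (hf : JCont f) (c : ℝ) :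
    JCont fun x y s => f x y s * Real.exp (s ^ 2 / c) := by
  have := hf
  unfold JCont at *
  fun_prop

theorem JCont.phiF {f : ℝ → ℝ → ℝ → ℝ} (hf : JCont f) (t : ℝ) : JCont (phiF t f) := by
  have h := intervalIntegral.continuous_parametric_intervalIntegral_of_continuous
    (μ := volume) (a₀ := 0) (s := fun p : ℝ × ℝ × ℝ => p.2.2)
    (f := fun (p : ℝ × ℝ × ℝ) s => f p.1 p.2.1 s * Real.exp (s ^ 2 / (4 * angT t)))
    (by
      have h := hf.integrand (4 * angT t)
      exact h.comp (a := fun q : (ℝ × ℝ × ℝ) × ℝ => q.1.1) (b := fun q => q.1.2.1)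
        (c := fun q => q.2) (by fun_prop) (by fun_prop) (by fun_prop)) (by fun_prop)
  unfold JCont _root_.phiF
  exact Continuous.mul (by fun_prop) h

theorem hasDerivAt_intervalIntegral_of_continuous {F F' : ℝ → ℝ → ℝ}
    (hF : Continuous F.uncurry) (hF' : Continuous F'.uncurry)
    (hd : ∀ x s, HasDerivAt (fun x => F x s) (F' x s) x) (a b x : ℝ) :
    HasDerivAt (fun x => ∫ s in a..b, F x s) (∫ s in a..b, F' x s) x := by
  obtain ⟨M, hM⟩ := ((isCompact_closedBall x 1).prod (isCompact_uIcc (a := a) (b := b))).exists_bound_of_continuousOn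
    hF'.continuousOn
  have c1 : ∀ x, Continuous (F x) := fun x => hF.comp (by fun_prop : Continuous fun s => (x, s))
  have c2 : ∀ x, Continuous (F' x) := fun x => hF'.comp (by fun_prop : Continuous fun s => (x, s))
  refine (intervalIntegral.hasDerivAt_integral_of_dominated_loc_of_deriv_le
    (F := F) (F' := F') (bound := fun _ => M)
    (Metric.ball_mem_nhds x one_pos) (.of_forall fun x => (c1 x).aestronglyMeasurable)
    ((c1 x).intervalIntegrable _ _) (c2 x).aestronglyMeasurable
    (.of_forall fun s hs u hu => ?_) intervalIntegrable_const
    (.of_forall fun s _ u _ => hd u s)).2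
  exact hM (u, s) ⟨Metric.ball_subset_closedBall hu, uIoc_subset_uIcc hs⟩

theorem IsTower.phiF {U : ℕ → ℕ → ℝ → ℝ → ℝ → ℝ} (hU : IsTower U) (t : ℝ) :
    IsTower fun i j => phiF t (U i j) where
  cont i j := (hU.cont i j).phiF t
  dx i j x y z := by
    refine (hasDerivAt_intervalIntegral_of_continuous
      (F := fun x s => U i j x y s * Real.exp (s ^ 2 / (4 * angT t)))
      (F' := fun x s => U (i + 1) j x y s * Real.exp (s ^ 2 / (4 * angT t)))
      ?_ ?_ (fun x s => (hU.dx i j x y s).mul_const _) 0 z x).const_mul _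
    · exact ((hU.cont i j).integrand (4 * angT t)).comp continuous_fst continuous_const
        continuous_snd
    · exact ((hU.cont (i + 1) j).integrand (4 * angT t)).comp continuous_fst continuous_const
        continuous_snd
  dy i j x y z := by
    refine (hasDerivAt_intervalIntegral_of_continuous
      (F := fun y s => U i j x y s * Real.exp (s ^ 2 / (4 * angT t)))
      (F' := fun y s => U i (j + 1) x y s * Real.exp (s ^ 2 / (4 * angT t)))
      ?_ ?_ (fun y s => (hU.dy i j x y s).mul_const _) 0 z y).const_mul _
    · exact ((hU.cont i j).integrand (4 * angT t)).comp continuous_const continuous_fst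
        continuous_snd
    · exact ((hU.cont i (j + 1)).integrand (4 * angT t)).comp continuous_const continuous_fst
        continuous_snd

/-- The `∂_x^i ∂_y^j`-derivative of `-(x∂_x + y∂_y) φ - 2 φ` for a tower `P` over `φ`. -/
def scalTower (P : ℕ → ℕ → ℝ → ℝ → ℝ → ℝ) (i j : ℕ) (x y z : ℝ) : ℝ :=
  -(x * P (i + 1) j x y z + y * P i (j + 1) x y z) - ((i : ℝ) + j + 2) * P i j x y z

theorem IsTower.scalTower {P : ℕ → ℕ → ℝ → ℝ → ℝ → ℝ} (hP : IsTower P) :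
    IsTower (scalTower P) where
  cont i j := by
    have h0 := hP.cont i j
    have h1 := hP.cont (i + 1) j
    have h2 := hP.cont i (j + 1)
    unfold JCont _root_.scalTower at *
    fun_prop
  dx i j x y z := by
    have h := ((((hasDerivAt_id x).mul (hP.dx (i + 1) j x y z)).add
      ((hP.dx i (j + 1) x y z).const_mul y)).neg).sub
        ((hP.dx i j x y z).const_mul ((i : ℝ) + j + 2))
    refine h.congr_deriv ?_
    simp only [_root_.scalTower, id]
    push_cast
    ring
  dy i j x y z := by
    have h := ((((hP.dy (i + 1) j x y z).const_mul x).add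
      ((hasDerivAt_id y).mul (hP.dy i (j + 1) x y z))).neg).sub
        ((hP.dy i j x y z).const_mul ((i : ℝ) + j + 2))
    refine h.congr_deriv ?_
    simp only [_root_.scalTower, id]
    push_cast
    ring

theorem IsTower.uzv_eq {U : ℕ → ℕ → ℝ → ℝ → ℝ → ℝ} (hU : IsTower U) (t : ℝ) :
    uzv t (U 0 0) = _root_.scalTower (fun i j => _root_.phiF t (U i j)) 0 0 := by
  funext x y z
  have h1 := ((hU.phiF t).dx 0 0 x y z).deriv
  have h2 := ((hU.phiF t).dy 0 0 x y z).deriv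
  simp only [uzv, rdr, _root_.pdx, _root_.pdy, _root_.scalTower, h1, h2]
  push_cast
  ring

theorem hasDerivAt_leibniz {u v : ℕ → ℝ → ℝ} {s : ℝ}
    (hu : ∀ i, HasDerivAt (u i) (u (i + 1) s) s) (hv : ∀ i, HasDerivAt (v i) (v (i + 1) s) s)
    (n : ℕ) :
    HasDerivAt (fun s => ∑ p ∈ Finset.HasAntidiagonal.antidiagonal n, (n.choose p.1 : ℝ) * (u p.1 s * v p.2 s))
      (∑ p ∈ Finset.HasAntidiagonal.antidiagonal (n + 1), ((n + 1).choose p.1 : ℝ) * (u p.1 s * v p.2 s)) s := by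
  have h := HasDerivAt.fun_sum (u := Finset.HasAntidiagonal.antidiagonal n) fun p _ =>
    ((hu p.1).mul (hv p.2)).const_mul (n.choose p.1 : ℝ)
  refine h.congr_deriv ?_
  rw [Finset.sum_antidiagonal_choose_succ_mul (fun i j => u i s * v j s), ← Finset.sum_add_distrib]
  refine Finset.sum_congr rfl fun p hp => ?_
  rw [← Finset.HasAntidiagonal.mem_antidiagonal.1 hp, ← Nat.choose_symm_add]
  ring

/-- The Leibniz formula for a product of towers. -/
def mulTower (U V : ℕ → ℕ → ℝ → ℝ → ℝ → ℝ) (a b : ℕ) (x y z : ℝ) : ℝ :=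
  ∑ p ∈ Finset.HasAntidiagonal.antidiagonal a, ∑ q ∈ Finset.HasAntidiagonal.antidiagonal b,
    (a.choose p.1 : ℝ) * (b.choose q.1) * (U p.1 q.1 x y z * V p.2 q.2 x y z)

theorem IsTower.mulTower {U V : ℕ → ℕ → ℝ → ℝ → ℝ → ℝ} (hU : IsTower U) (hV : IsTower V) :
    IsTower (mulTower U V) where
  cont a b := by
    unfold JCont _root_.mulTower
    refine continuous_finsetSum _ fun p _ => continuous_finsetSum _ fun q _ => ?_
    have h0 := hU.cont p.1 q.1
    have h1 := hV.cont p.2 q.2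
    unfold JCont at *
    fun_prop
  dx a b x y z := by
    have e : ∀ a x, _root_.mulTower U V a b x y z = ∑ q ∈ Finset.HasAntidiagonal.antidiagonal b,
        (b.choose q.1 : ℝ) * ∑ p ∈ Finset.HasAntidiagonal.antidiagonal a,
          (a.choose p.1 : ℝ) * (U p.1 q.1 x y z * V p.2 q.2 x y z) := by
      intro a x
      rw [_root_.mulTower, Finset.sum_comm]
      refine Finset.sum_congr rfl fun q _ => ?_
      rw [Finset.mul_sum]
      exact Finset.sum_congr rfl fun p _ => by ring
    simp only [e]
    exact HasDerivAt.fun_sum fun q _ => (hasDerivAt_leibniz (u := fun i s => U i q.1 s y z)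
      (v := fun i s => V i q.2 s y z) (fun i => hU.dx i q.1 x y z)
      (fun i => hV.dx i q.2 x y z) a).const_mul _
  dy a b x y z := by
    have e : ∀ b y, _root_.mulTower U V a b x y z = ∑ p ∈ Finset.HasAntidiagonal.antidiagonal a,
        (a.choose p.1 : ℝ) * ∑ q ∈ Finset.HasAntidiagonal.antidiagonal b,
          (b.choose q.1 : ℝ) * (U p.1 q.1 x y z * V p.2 q.2 x y z) := by
      intro b y
      rw [_root_.mulTower]
      refine Finset.sum_congr rfl fun q _ => ?_
      rw [Finset.mul_sum]
      exact Finset.sum_congr rfl fun p _ => by ring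
    simp only [e]
    exact HasDerivAt.fun_sum fun p _ => (hasDerivAt_leibniz (u := fun j s => U p.1 j x s z)
      (v := fun j s => V p.2 j x s z) (fun j => hU.dy p.1 j x y z)
      (fun j => hV.dy p.2 j x y z) b).const_mul _

theorem IsTower.pdh_mul {U V : ℕ → ℕ → ℝ → ℝ → ℝ → ℝ} (hU : IsTower U) (hV : IsTower V)
    (a b : ℕ) :
    pdh a b (fun x y z => U 0 0 x y z * V 0 0 x y z) = _root_.mulTower U V a b := by
  rw [← (hU.mulTower hV).pdh_eq]
  congr 1
  funext x y z
  simp [_root_.mulTower]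


theorem lintegral_mul_sq_le {α : Type*} [MeasurableSpace α] (μ : Measure α) {f g : α → ENNReal}
    (hf : AEMeasurable f μ) (hg : AEMeasurable g μ) :
    (∫⁻ a, f a * g a ∂μ) ^ 2 ≤ (∫⁻ a, f a ^ 2 ∂μ) * ∫⁻ a, g a ^ 2 ∂μ := by
  have h := ENNReal.lintegral_mul_le_Lp_mul_Lq μ Real.HolderConjugate.two_two hf hg
  have e : ∀ A : ENNReal, (A ^ (1 / (2 : ℝ))) ^ 2 = A := fun A => by
    rw [← ENNReal.rpow_natCast, ← ENNReal.rpow_mul]; norm_num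
  simp only [Pi.mul_apply, ENNReal.rpow_ofNat] at h
  calc _ ≤ _ := pow_le_pow_left₀ zero_le h 2
    _ = _ := by rw [mul_pow, e, e]

theorem ennreal_add_sq_le (a b : ENNReal) : (a + b) ^ 2 ≤ 2 * (a ^ 2 + b ^ 2) := by
  have h := ENNReal.inner_le_Lp_mul_Lq (Finset.univ : Finset (Fin 2)) ![a, b] ![1, 1]
    Real.HolderConjugate.two_two
  have e : ∀ A : ENNReal, (A ^ (1 / (2 : ℝ))) ^ 2 = A := fun A => by
    rw [← ENNReal.rpow_natCast, ← ENNReal.rpow_mul]; norm_num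
  simp only [Fin.sum_univ_two, Matrix.cons_val_zero, Matrix.cons_val_one, mul_one,
    ENNReal.rpow_ofNat, one_pow] at h
  calc _ ≤ _ := pow_le_pow_left₀ zero_le h 2
    _ = _ := by rw [mul_pow, e, e, one_add_one_eq_two, mul_comm]

theorem enorm_le_of_nonneg_of_le {a b : ℝ} (ha : 0 ≤ a) (h : a ≤ b) : ‖a‖ₑ ≤ ‖b‖ₑ := by
  rw [Real.enorm_of_nonneg ha, Real.enorm_of_nonneg (ha.trans h)]
  exact ENNReal.ofReal_le_ofReal h

theorem enorm_sq_le_setLIntegral {f f' : ℝ → ℝ} (hf : ∀ s, HasDerivAt f (f' s) s)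
    (hf' : Continuous f') (x : ℝ) :
    ‖f x‖ₑ ^ 2 ≤ 2 * ∫⁻ s in Ioc x (x + 1), (‖f s‖ₑ ^ 2 + ‖f' s‖ₑ ^ 2) := by
  have hc : Continuous f := continuous_iff_continuousAt.2 fun s => (hf s).continuousAt
  have hI : (∫⁻ s in Ioc x (x + 1), ‖f' s‖ₑ) ^ 2 ≤ ∫⁻ s in Ioc x (x + 1), ‖f' s‖ₑ ^ 2 := by
    have h := lintegral_mul_sq_le (volume.restrict (Ioc x (x + 1))) (f := fun s => ‖f' s‖ₑ)
      (g := fun _ => 1) hf'.measurable.enorm.aemeasurable aemeasurable_const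
    simpa using h
  have hs : ∀ s ∈ Ioc x (x + 1), ‖f x‖ₑ ^ 2 ≤
      2 * (‖f s‖ₑ ^ 2 + ∫⁻ s in Ioc x (x + 1), ‖f' s‖ₑ ^ 2) := by
    intro s hs
    have h1 : ‖f x‖ₑ ≤ ‖f s‖ₑ + ∫⁻ s in Ioc x (x + 1), ‖f' s‖ₑ := by
      have h2 : f x = f s - ∫ r in x..s, f' r := by
        rw [intervalIntegral.integral_eq_sub_of_hasDerivAt (fun r _ => hf r)
          (hf'.intervalIntegrable _ _)]
        ring
      rw [h2]
      refine (enorm_sub_le).trans (add_le_add le_rfl ?_)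
      rw [intervalIntegral.integral_of_le hs.1.le]
      exact (enorm_integral_le_lintegral_enorm _).trans
        (lintegral_mono_set (Ioc_subset_Ioc_right hs.2))
    exact (pow_le_pow_left₀ zero_le h1 2).trans ((ennreal_add_sq_le _ _).trans
      (mul_le_mul_right (add_le_add le_rfl hI) _))
  have h := setLIntegral_mono' (μ := volume) measurableSet_Ioc hs
  simp only [setLIntegral_const, Real.volume_Ioc, add_sub_cancel_left, ENNReal.ofReal_one,
    mul_one] at h
  refine h.trans (le_of_eq ?_)
  rw [lintegral_const_mul _ (by fun_prop), lintegral_add_right _ measurable_const,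
    lintegral_add_right _ (by fun_prop)]
  simp only [lintegral_const, Measure.restrict_apply_univ, Real.volume_Ioc, add_sub_cancel_left,
    ENNReal.ofReal_one, mul_one]

/-- A weighted one-dimensional Sobolev inequality, for weights that grow away from the origin. -/
theorem weight_mul_enorm_sq_le {f f' : ℝ → ℝ} (hf : ∀ s, HasDerivAt f (f' s) s)
    (hf' : Continuous f') {w : ℝ → ENNReal} (hw : ∀ x s, |x| ≤ |s| → w x ≤ w s) (x : ℝ) :
    w x * ‖f x‖ₑ ^ 2 ≤ 2 * ∫⁻ s, w s * (‖f s‖ₑ ^ 2 + ‖f' s‖ₑ ^ 2) := by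
  have main : ∀ {f f' : ℝ → ℝ}, (∀ s, HasDerivAt f (f' s) s) → Continuous f' →
      ∀ {w : ℝ → ENNReal}, (∀ x s, |x| ≤ |s| → w x ≤ w s) → ∀ {x}, 0 ≤ x →
      w x * ‖f x‖ₑ ^ 2 ≤ 2 * ∫⁻ s, w s * (‖f s‖ₑ ^ 2 + ‖f' s‖ₑ ^ 2) := by
    intro f f' hf hf' w hw x hx
    have hc : Continuous f := continuous_iff_continuousAt.2 fun s => (hf s).continuousAt
    calc w x * ‖f x‖ₑ ^ 2
        ≤ w x * (2 * ∫⁻ s in Ioc x (x + 1), (‖f s‖ₑ ^ 2 + ‖f' s‖ₑ ^ 2)) :=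
          mul_le_mul_right (enorm_sq_le_setLIntegral hf hf' x) _
      _ = 2 * ∫⁻ s in Ioc x (x + 1), w x * (‖f s‖ₑ ^ 2 + ‖f' s‖ₑ ^ 2) := by
          rw [lintegral_const_mul _ (by fun_prop)]; ring
      _ ≤ 2 * ∫⁻ s in Ioc x (x + 1), w s * (‖f s‖ₑ ^ 2 + ‖f' s‖ₑ ^ 2) := by
          refine mul_le_mul_right (setLIntegral_mono' measurableSet_Ioc fun s hs => ?_) _
          exact mul_le_mul_left (hw _ _ (by
            rw [abs_of_nonneg hx, abs_of_nonneg (hx.trans hs.1.le)]; exact hs.1.le)) _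
      _ ≤ _ := mul_le_mul_right (setLIntegral_le_lintegral _ _) _
  rcases le_total 0 x with hx | hx
  · exact main hf hf' hw hx
  · have h := main (f := fun s => f (-s)) (f' := fun s => -f' (-s)) (w := fun s => w (-s))
      (x := -x) (fun s => ((hf (-s)).comp s (hasDerivAt_neg s)).congr_deriv (mul_neg_one _)) (by fun_prop)
      (fun a b hab => hw _ _ (by simpa using hab)) (by linarith)
    simp only [neg_neg, enorm_neg] at h
    rwa [lintegral_neg_eq_self (fun s => w s * (‖f s‖ₑ ^ 2 + ‖f' s‖ₑ ^ 2))] at h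

/-- The square of the weighted `L²_z` norm at fixed `(x, y)`, in `[0, ∞]`. -/
def slice (t : ℝ) (k : ℕ) (f : ℝ → ℝ → ℝ → ℝ) (x y : ℝ) : ENNReal :=
  ∫⁻ z in Ioi (0 : ℝ), ‖thw t 1 z * angR x y ^ k * f x y z‖ₑ ^ 2

/-- The square of the weighted `L²` norm, in `[0, ∞]`. -/
def normSq (t : ℝ) (k : ℕ) (f : ℝ → ℝ → ℝ → ℝ) : ENNReal := ∫⁻ x, ∫⁻ y, slice t k f x y

theorem continuous_thw (t lam : ℝ) : Continuous (thw t lam) := by unfold thw; fun_prop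

theorem continuous_angR : Continuous fun p : ℝ × ℝ => angR p.1 p.2 := by unfold angR; fun_prop

theorem one_le_angR (x y : ℝ) : 1 ≤ angR x y :=
  Real.one_le_sqrt.2 (by nlinarith [sq_nonneg x, sq_nonneg y])

theorem angR_le_angR_left {x s : ℝ} (h : |x| ≤ |s|) (y : ℝ) : angR x y ≤ angR s y :=
  Real.sqrt_le_sqrt (by nlinarith [sq_le_sq.2 h])

theorem angR_le_angR_right {y s : ℝ} (h : |y| ≤ |s|) (x : ℝ) : angR x y ≤ angR x s :=
  Real.sqrt_le_sqrt (by nlinarith [sq_le_sq.2 h])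

theorem abs_fst_le_angR (x y : ℝ) : |x| ≤ angR x y :=
  Real.abs_le_sqrt (by nlinarith [sq_nonneg y])

theorem abs_snd_le_angR (x y : ℝ) : |y| ≤ angR x y :=
  Real.abs_le_sqrt (by nlinarith [sq_nonneg x])

theorem thw_pos (t lam z : ℝ) : 0 < thw t lam z := Real.exp_pos _

theorem JCont.weighted {f : ℝ → ℝ → ℝ → ℝ} (hf : JCont f) (t : ℝ) (k : ℕ) :
    Continuous fun p : ℝ × ℝ × ℝ => thw t 1 p.2.2 * angR p.1 p.2.1 ^ k * f p.1 p.2.1 p.2.2 := by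
  have h1 := (continuous_thw t 1).comp (by fun_prop : Continuous fun p : ℝ × ℝ × ℝ => p.2.2)
  have h2 := continuous_angR.comp (by fun_prop : Continuous fun p : ℝ × ℝ × ℝ => (p.1, p.2.1))
  exact (h1.mul (h2.pow k)).mul hf

theorem JCont.measurable_slice {f : ℝ → ℝ → ℝ → ℝ} (hf : JCont f) (t : ℝ) (k : ℕ) :
    Measurable fun p : ℝ × ℝ => slice t k f p.1 p.2 := by
  have h : Measurable fun q : (ℝ × ℝ) × ℝ =>
      ‖thw t 1 q.2 * angR q.1.1 q.1.2 ^ k * f q.1.1 q.1.2 q.2‖ₑ ^ 2 :=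
    ((hf.weighted t k).comp (by fun_prop :
      Continuous fun q : (ℝ × ℝ) × ℝ => (q.1.1, q.1.2, q.2))).measurable.enorm.pow_const 2
  exact h.lintegral_prod_right'

theorem slice_mono (t : ℝ) {k l : ℕ} (h : k ≤ l) (f : ℝ → ℝ → ℝ → ℝ) (x y : ℝ) :
    slice t k f x y ≤ slice t l f x y := by
  refine lintegral_mono fun z => pow_le_pow_left₀ zero_le ?_ 2
  simp only [enorm_mul]
  refine mul_le_mul_left (mul_le_mul_right ?_ _) _
  refine enorm_le_of_nonneg_of_le (pow_nonneg (zero_le_one.trans (one_le_angR x y)) _) ?_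
  exact pow_le_pow_right₀ (one_le_angR x y) h

theorem normSq_mono (t : ℝ) {k l : ℕ} (h : k ≤ l) (f : ℝ → ℝ → ℝ → ℝ) :
    normSq t k f ≤ normSq t l f :=
  lintegral_mono fun x => lintegral_mono fun y => slice_mono t h f x y

theorem slice_le_x {t : ℝ} {f f' : ℝ → ℝ → ℝ → ℝ} (hf : JCont f) (hf' : JCont f')
    (hd : ∀ x y z, HasDerivAt (fun s => f s y z) (f' x y z) x) (k : ℕ) (x y : ℝ) :
    slice t k f x y ≤ 2 * ∫⁻ s, (slice t k f s y + slice t k f' s y) := by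
  have hmf (h : ℝ → ℝ → ℝ → ℝ) (hh : JCont h) :
      Measurable fun q : ℝ × ℝ => ‖thw t 1 q.1 * angR q.2 y ^ k * h q.2 y q.1‖ₑ ^ 2 :=
    ((hh.weighted t k).comp (by fun_prop :
      Continuous fun q : ℝ × ℝ => (q.2, y, q.1))).measurable.enorm.pow_const 2
  calc slice t k f x y
      ≤ ∫⁻ z in Ioi (0 : ℝ), 2 * ∫⁻ s, (‖thw t 1 z * angR s y ^ k * f s y z‖ₑ ^ 2 +
          ‖thw t 1 z * angR s y ^ k * f' s y z‖ₑ ^ 2) := by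
        refine lintegral_mono fun z => ?_
        have h := weight_mul_enorm_sq_le (f := fun s => f s y z) (f' := fun s => f' s y z)
          (w := fun s => ‖thw t 1 z * angR s y ^ k‖ₑ ^ 2) (fun s => hd s y z)
          (hf'.comp continuous_id continuous_const continuous_const) (fun a b hab => by
            have := angR_le_angR_left hab y
            have h0 := one_le_angR a y
            have h1 := thw_pos t 1 z
            refine pow_le_pow_left₀ zero_le ?_ 2
            refine enorm_le_of_nonneg_of_le (by positivity) ?_
            gcongr) x
        simpa only [enorm_mul, mul_pow, mul_add] using h
    _ = 2 * ∫⁻ s, (slice t k f s y + slice t k f' s y) := by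
        have hm : Measurable fun q : ℝ × ℝ => ‖thw t 1 q.1 * angR q.2 y ^ k * f q.2 y q.1‖ₑ ^ 2 +
            ‖thw t 1 q.1 * angR q.2 y ^ k * f' q.2 y q.1‖ₑ ^ 2 := (hmf f hf).add (hmf f' hf')
        have h1 := hm.lintegral_prod_right' (ν := (volume : Measure ℝ))
        have h2 := lintegral_lintegral_swap (μ := volume.restrict (Ioi (0 : ℝ)))
          (ν := (volume : Measure ℝ)) (f := fun z s => ‖thw t 1 z * angR s y ^ k * f s y z‖ₑ ^ 2 +
            ‖thw t 1 z * angR s y ^ k * f' s y z‖ₑ ^ 2) hm.aemeasurable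
        rw [lintegral_const_mul _ h1, h2]
        congr 2
        funext s
        exact lintegral_add_left ((hmf f hf).comp measurable_prodMk_right) _

theorem slice_le_y {t : ℝ} {f f' : ℝ → ℝ → ℝ → ℝ} (hf : JCont f) (hf' : JCont f')
    (hd : ∀ x y z, HasDerivAt (fun s => f x s z) (f' x y z) y) (k : ℕ) (x y : ℝ) :
    slice t k f x y ≤ 2 * ∫⁻ s, (slice t k f x s + slice t k f' x s) := by
  have hmf (h : ℝ → ℝ → ℝ → ℝ) (hh : JCont h) :
      Measurable fun q : ℝ × ℝ => ‖thw t 1 q.1 * angR x q.2 ^ k * h x q.2 q.1‖ₑ ^ 2 :=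
    ((hh.weighted t k).comp (by fun_prop :
      Continuous fun q : ℝ × ℝ => (x, q.2, q.1))).measurable.enorm.pow_const 2
  calc slice t k f x y
      ≤ ∫⁻ z in Ioi (0 : ℝ), 2 * ∫⁻ s, (‖thw t 1 z * angR x s ^ k * f x s z‖ₑ ^ 2 +
          ‖thw t 1 z * angR x s ^ k * f' x s z‖ₑ ^ 2) := by
        refine lintegral_mono fun z => ?_
        have h := weight_mul_enorm_sq_le (f := fun s => f x s z) (f' := fun s => f' x s z)
          (w := fun s => ‖thw t 1 z * angR x s ^ k‖ₑ ^ 2) (fun s => hd x s z)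
          (hf'.comp continuous_const continuous_id continuous_const) (fun a b hab => by
            have := angR_le_angR_right hab x
            have h0 := one_le_angR x a
            have h1 := thw_pos t 1 z
            refine pow_le_pow_left₀ zero_le ?_ 2
            refine enorm_le_of_nonneg_of_le (by positivity) ?_
            gcongr) y
        simpa only [enorm_mul, mul_pow, mul_add] using h
    _ = 2 * ∫⁻ s, (slice t k f x s + slice t k f' x s) := by
        have hm : Measurable fun q : ℝ × ℝ => ‖thw t 1 q.1 * angR x q.2 ^ k * f x q.2 q.1‖ₑ ^ 2 +
            ‖thw t 1 q.1 * angR x q.2 ^ k * f' x q.2 q.1‖ₑ ^ 2 := (hmf f hf).add (hmf f' hf')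
        have h1 := hm.lintegral_prod_right' (ν := (volume : Measure ℝ))
        have h2 := lintegral_lintegral_swap (μ := volume.restrict (Ioi (0 : ℝ)))
          (ν := (volume : Measure ℝ)) (f := fun z s => ‖thw t 1 z * angR x s ^ k * f x s z‖ₑ ^ 2 +
            ‖thw t 1 z * angR x s ^ k * f' x s z‖ₑ ^ 2) hm.aemeasurable
        rw [lintegral_const_mul _ h1, h2]
        congr 2
        funext s
        exact lintegral_add_left ((hmf f hf).comp measurable_prodMk_right) _

theorem two_mul_lintegral_two_mul {A B C D : ℝ → ℝ → ENNReal}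
    (hA : Measurable A.uncurry) (hB : Measurable B.uncurry) (hC : Measurable C.uncurry) :
    2 * ∫⁻ s, ((2 * ∫⁻ u, (A s u + B s u)) + 2 * ∫⁻ u, (C s u + D s u)) =
      4 * ((∫⁻ s, ∫⁻ u, A s u) + (∫⁻ s, ∫⁻ u, C s u) + (∫⁻ s, ∫⁻ u, B s u)
        + ∫⁻ s, ∫⁻ u, D s u) := by
  have m (F : ℝ → ℝ → ENNReal) (hF : Measurable F.uncurry) (s : ℝ) : Measurable (F s) :=
    hF.comp measurable_prodMk_left
  have n (F : ℝ → ℝ → ENNReal) (hF : Measurable F.uncurry) : Measurable fun s => ∫⁻ u, F s u :=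
    hF.lintegral_prod_right'
  have e (s : ℝ) : (2 * ∫⁻ u, (A s u + B s u)) + 2 * ∫⁻ u, (C s u + D s u) =
      2 * ((∫⁻ u, A s u) + (∫⁻ u, C s u) + (∫⁻ u, B s u) + ∫⁻ u, D s u) := by
    rw [lintegral_add_left (m A hA s), lintegral_add_left (m C hC s)]
    ring
  simp only [e]
  rw [lintegral_const_mul' _ _ (by simp), lintegral_add_left (((n A hA).fun_add (n C hC)).fun_add (n B hB)),
    lintegral_add_left ((n A hA).fun_add (n C hC)), lintegral_add_left (n A hA), ← mul_assoc]
  norm_num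

/-- The weighted embedding of `H²` type into `L^∞_h L²_z` along a tower of derivatives. -/
theorem IsTower.slice_le {U : ℕ → ℕ → ℝ → ℝ → ℝ → ℝ} (hU : IsTower U) (t : ℝ) (i j : ℕ)
    (x y : ℝ) :
    slice t (i + j) (U i j) x y ≤ 4 * (normSq t (i + j) (U i j)
      + normSq t (i + 1 + j) (U (i + 1) j) + normSq t (i + (j + 1)) (U i (j + 1))
      + normSq t (i + 1 + (j + 1)) (U (i + 1) (j + 1))) := by
  have hm (i' j' : ℕ) : Measurable (slice t (i + j) (U i' j')).uncurry :=
    (hU.cont i' j').measurable_slice t (i + j)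
  have h1 := slice_le_x (t := t) (hU.cont i j) (hU.cont (i + 1) j) (hU.dx i j) (i + j) x y
  have h2 (s : ℝ) :=
    slice_le_y (t := t) (hU.cont i j) (hU.cont i (j + 1)) (hU.dy i j) (i + j) s y
  have h3 (s : ℝ) := slice_le_y (t := t) (hU.cont (i + 1) j) (hU.cont (i + 1) (j + 1))
    (hU.dy (i + 1) j) (i + j) s y
  refine h1.trans ((mul_le_mul_right (lintegral_mono fun s => add_le_add (h2 s) (h3 s)) 2).trans ?_)
  rw [two_mul_lintegral_two_mul (hm i j) (hm i (j + 1)) (hm (i + 1) j)]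
  refine mul_le_mul_right (add_le_add (add_le_add (add_le_add le_rfl ?_) ?_) ?_) 4 <;>
  exact normSq_mono t (by omega) _


theorem sqrt_pi_mul_le {T : ℝ} (hT : 0 ≤ T) : √(Real.pi / (1 / (4 * T))) ≤ 4 * √T := by
  rw [show (4 : ℝ) * √T = √(16 * T) by
    rw [Real.sqrt_mul (by norm_num), show (16 : ℝ) = 4 ^ 2 by norm_num,
      Real.sqrt_sq (by norm_num)]]
  refine Real.sqrt_le_sqrt ?_
  rw [div_div_eq_mul_div, div_one]
  nlinarith [Real.pi_le_four]

theorem lintegral_gaussian_sub_le {T : ℝ} (hT : 0 < T) (z : ℝ) :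
    ∫⁻ s, ENNReal.ofReal (Real.exp (-(1 / (4 * T)) * (z - s) ^ 2)) ≤ ENNReal.ofReal (4 * √T) := by
  rw [lintegral_sub_left_eq_self (fun s => ENNReal.ofReal (Real.exp (-(1 / (4 * T)) * s ^ 2))),
    ← ofReal_integral_eq_lintegral_ofReal (integrable_exp_neg_mul_sq (by positivity))
      (.of_forall fun _ => (Real.exp_pos _).le), integral_gaussian]
  exact ENNReal.ofReal_le_ofReal (sqrt_pi_mul_le hT.le)

theorem slice_eq {t : ℝ} {f : ℝ → ℝ → ℝ → ℝ} (k : ℕ) (x y : ℝ) :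
    slice t k f x y = ‖angR x y ^ k‖ₑ ^ 2 * slice t 0 f x y := by
  unfold slice
  rw [← lintegral_const_mul' _ _ (by simp)]
  refine lintegral_congr fun z => ?_
  simp only [enorm_mul, pow_zero, mul_pow, mul_one]
  ring

theorem JCont.enorm_phiF_sq_le {f : ℝ → ℝ → ℝ → ℝ} (hf : JCont f) {t : ℝ} (ht : 0 ≤ t) (k : ℕ)
    (x y : ℝ) {z : ℝ} (hz : 0 < z) :
    ‖angR x y ^ k * _root_.phiF t f x y z‖ₑ ^ 2 ≤
      ENNReal.ofReal (4 * √(angT t)) * slice t k f x y := by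
  have hT : 0 < angT t := by unfold angT; linarith
  rw [enorm_mul, mul_pow, slice_eq, mul_left_comm]
  refine mul_le_mul_right ?_ _
  set T := angT t with hTd
  have hc : Continuous fun s => f x y s := hf.comp continuous_const continuous_const continuous_id
  have hmA : Measurable fun s : ℝ => ‖Real.exp (-(z ^ 2) / (4 * T) + s ^ 2 / (8 * T))‖ₑ := by
    fun_prop
  have hmB : Measurable fun s : ℝ => ‖thw t 1 s * angR x y ^ 0 * f x y s‖ₑ := by
    have := continuous_thw t 1
    have h : Continuous fun s : ℝ => thw t 1 s * angR x y ^ 0 * f x y s := by fun_prop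
    exact h.measurable.enorm
  have h1 : ‖_root_.phiF t f x y z‖ₑ ≤ ∫⁻ s in Ioc 0 z,
      ‖Real.exp (-(z ^ 2) / (4 * T) + s ^ 2 / (8 * T))‖ₑ *
        ‖thw t 1 s * angR x y ^ 0 * f x y s‖ₑ := by
    rw [_root_.phiF, ← intervalIntegral.integral_const_mul, intervalIntegral.integral_of_le hz.le]
    refine (enorm_integral_le_lintegral_enorm _).trans (lintegral_mono fun s => le_of_eq ?_)
    rw [← enorm_mul]
    congr 1
    simp only [thw, pow_zero, mul_one, one_mul, ← hTd]
    rw [show s ^ 2 / (4 * T) = s ^ 2 / (8 * T) + s ^ 2 / (8 * T) by ring, Real.exp_add,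
      Real.exp_add]
    ring
  calc ‖_root_.phiF t f x y z‖ₑ ^ 2
      ≤ (∫⁻ s in Ioc 0 z, ‖Real.exp (-(z ^ 2) / (4 * T) + s ^ 2 / (8 * T))‖ₑ ^ 2) *
        ∫⁻ s in Ioc 0 z, ‖thw t 1 s * angR x y ^ 0 * f x y s‖ₑ ^ 2 :=
        (pow_le_pow_left₀ zero_le h1 2).trans
          (lintegral_mul_sq_le _ hmA.aemeasurable hmB.aemeasurable)
    _ ≤ (∫⁻ s, ENNReal.ofReal (Real.exp (-(1 / (4 * T)) * (z - s) ^ 2))) *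
        slice t 0 f x y := by
        refine mul_le_mul' ?_ (lintegral_mono_set Ioc_subset_Ioi_self)
        refine (setLIntegral_mono' measurableSet_Ioc fun s hs => ?_).trans
          (setLIntegral_le_lintegral _ _)
        rw [Real.enorm_of_nonneg (Real.exp_pos _).le, ← ENNReal.ofReal_pow (Real.exp_pos _).le,
          ← Real.exp_nat_mul]
        refine ENNReal.ofReal_le_ofReal (Real.exp_le_exp.2 ?_)
        have e : -(1 / (4 * T)) * (z - s) ^ 2 -
            ((2 : ℕ) : ℝ) * (-(z ^ 2) / (4 * T) + s ^ 2 / (8 * T)) =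
            (z ^ 2 + 2 * s * (z - s)) / (4 * T) := by
          push_cast; field_simp; ring
        have h2 : 0 ≤ (z ^ 2 + 2 * s * (z - s)) / (4 * T) := by
          have := mul_nonneg hs.1.le (sub_nonneg.2 hs.2)
          have := sq_nonneg z
          exact div_nonneg (by linarith) (by positivity)
        linarith
    _ ≤ _ := mul_le_mul_left (lintegral_gaussian_sub_le hT z) _

/-- The square function controlling the `∂_x^i ∂_y^j`-derivative of the vertical velocity. -/
def velSq (t : ℝ) (U : ℕ → ℕ → ℝ → ℝ → ℝ → ℝ) (i j : ℕ) (x y : ℝ) : ENNReal :=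
  slice t (i + 1 + j) (U (i + 1) j) x y + slice t (i + (j + 1)) (U i (j + 1)) x y
    + ENNReal.ofReal (((i : ℝ) + j + 2) ^ 2) * slice t (i + j) (U i j) x y

theorem IsTower.enorm_scalTower_sq_le {U : ℕ → ℕ → ℝ → ℝ → ℝ → ℝ} (hU : IsTower U) {t : ℝ}
    (ht : 0 ≤ t) (i j : ℕ) (x y : ℝ) {z : ℝ} (hz : 0 < z) :
    ‖angR x y ^ (i + j) * _root_.scalTower (fun i j => _root_.phiF t (U i j)) i j x y z‖ₑ ^ 2 ≤
      ENNReal.ofReal (16 * √(angT t)) * velSq t U i j x y := by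
  have hR := one_le_angR x y
  have hR0 : 0 < angR x y := by linarith
  have b1 := (hU.cont (i + 1) j).enorm_phiF_sq_le ht (i + 1 + j) x y hz
  have b2 := (hU.cont i (j + 1)).enorm_phiF_sq_le ht (i + (j + 1)) x y hz
  have b3 := (hU.cont i j).enorm_phiF_sq_le ht (i + j) x y hz
  set P := fun i j => _root_.phiF t (U i j) x y z with hP
  set A := ‖angR x y ^ (i + 1 + j) * P (i + 1) j‖ₑ
  set B := ‖angR x y ^ (i + (j + 1)) * P i (j + 1)‖ₑ
  set D := ‖angR x y ^ (i + j) * P i j‖ₑ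
  set m : ℝ := (i : ℝ) + j + 2 with hm
  have hm0 : 0 ≤ m := by positivity
  have h : ‖angR x y ^ (i + j) * _root_.scalTower (fun i j => _root_.phiF t (U i j)) i j x y z‖ₑ ≤
      (A + B) + ‖m‖ₑ * D := by
    have hx : ‖x * (angR x y ^ (i + j) * P (i + 1) j)‖ₑ ≤ A := by
      rw [show A = ‖angR x y * (angR x y ^ (i + j) * P (i + 1) j)‖ₑ by
        rw [← mul_assoc, ← pow_succ', add_right_comm], enorm_mul x, enorm_mul (angR x y)]
      refine mul_le_mul_left ?_ _
      rw [Real.enorm_eq_ofReal_abs, Real.enorm_of_nonneg hR0.le]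
      exact ENNReal.ofReal_le_ofReal (abs_fst_le_angR x y)
    have hy : ‖y * (angR x y ^ (i + j) * P i (j + 1))‖ₑ ≤ B := by
      rw [show B = ‖angR x y * (angR x y ^ (i + j) * P i (j + 1))‖ₑ by
        rw [← mul_assoc, ← pow_succ', add_assoc], enorm_mul y, enorm_mul (angR x y)]
      refine mul_le_mul_left ?_ _
      rw [Real.enorm_eq_ofReal_abs, Real.enorm_of_nonneg hR0.le]
      exact ENNReal.ofReal_le_ofReal (abs_snd_le_angR x y)
    rw [show angR x y ^ (i + j) * _root_.scalTower (fun i j => _root_.phiF t (U i j)) i j x y z =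
      -(x * (angR x y ^ (i + j) * P (i + 1) j) + y * (angR x y ^ (i + j) * P i (j + 1))) -
        m * (angR x y ^ (i + j) * P i j) by simp only [_root_.scalTower, hP, hm]; ring]
    refine enorm_sub_le.trans (add_le_add ?_ (enorm_mul _ _).le)
    rw [enorm_neg]
    exact (enorm_add_le _ _).trans (add_le_add hx hy)
  have hmm : ‖m‖ₑ ^ 2 = ENNReal.ofReal (m ^ 2) := by
    rw [Real.enorm_of_nonneg hm0, ENNReal.ofReal_pow hm0]
  calc _ ≤ ((A + B) + ‖m‖ₑ * D) ^ 2 := pow_le_pow_left₀ zero_le h 2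
    _ ≤ 2 * ((A + B) ^ 2 + (‖m‖ₑ * D) ^ 2) := ennreal_add_sq_le _ _
    _ ≤ 2 * (2 * (A ^ 2 + B ^ 2) + 2 * (‖m‖ₑ * D) ^ 2) := by
        gcongr
        · exact ennreal_add_sq_le _ _
        · exact le_mul_of_one_le_left zero_le (by norm_num)
    _ = 4 * (A ^ 2 + B ^ 2 + ENNReal.ofReal (m ^ 2) * D ^ 2) := by
        rw [mul_pow, hmm]; ring
    _ ≤ 4 * (ENNReal.ofReal (4 * √(angT t)) * slice t (i + 1 + j) (U (i + 1) j) x y +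
          ENNReal.ofReal (4 * √(angT t)) * slice t (i + (j + 1)) (U i (j + 1)) x y +
          ENNReal.ofReal (m ^ 2) *
            (ENNReal.ofReal (4 * √(angT t)) * slice t (i + j) (U i j) x y)) := by
        gcongr
    _ = _ := by
        rw [show (16 : ℝ) * √(angT t) = 4 * (4 * √(angT t)) by ring,
          ENNReal.ofReal_mul (q := 4 * √(angT t)) (by norm_num : (0 : ℝ) ≤ 4), velSq, ENNReal.ofReal_ofNat, ← hm]
        generalize slice t (i + 1 + j) (U (i + 1) j) x y = s₁,
          slice t (i + (j + 1)) (U i (j + 1)) x y = s₂, slice t (i + j) (U i j) x y = s₃,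
          ENNReal.ofReal (m ^ 2) = m', ENNReal.ofReal (4 * √(angT t)) = K
        ring

/-- Lebesgue measure on `ℝ² × (0,∞)`. -/
def halfSpace : Measure (ℝ × ℝ × ℝ) :=
  (volume : Measure ℝ).prod ((volume : Measure ℝ).prod (volume.restrict (Ioi (0 : ℝ))))

theorem volume_restrict_eq_halfSpace :
    (volume : Measure (ℝ × ℝ × ℝ)).restrict {p | 0 < p.2.2} = halfSpace := by
  have h : {p : ℝ × ℝ × ℝ | 0 < p.2.2} = univ ×ˢ (univ ×ˢ Ioi (0 : ℝ)) := by
    ext p; simp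
  rw [h, Measure.volume_eq_prod, Measure.volume_eq_prod, ← Measure.prod_restrict,
    ← Measure.prod_restrict, Measure.restrict_univ, halfSpace]

theorem lintegral_halfSpace {F : ℝ × ℝ × ℝ → ENNReal} (hF : Measurable F) :
    ∫⁻ p, F p ∂halfSpace = ∫⁻ x, ∫⁻ y, ∫⁻ z in Ioi (0 : ℝ), F (x, y, z) := by
  rw [halfSpace, lintegral_prod _ hF.aemeasurable]
  refine lintegral_congr fun x => ?_
  exact lintegral_prod (fun q => F (x, q)) (hF.comp measurable_prodMk_left).aemeasurable

theorem integral_halfSpace {F : ℝ × ℝ × ℝ → ℝ} (hF : Integrable F halfSpace) :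
    ∫ p, F p ∂halfSpace = ∫ x, ∫ y, ∫ z in Ioi (0 : ℝ), F (x, y, z) := by
  unfold halfSpace at hF ⊢
  rw [integral_prod _ hF]
  refine integral_congr_ae ?_
  filter_upwards [hF.prod_right_ae] with x hx
  exact integral_prod _ hx

theorem enorm_trip_le {F : ℝ → ℝ → ℝ → ℝ} (hF : JCont F) :
    ‖trip F‖ₑ ≤ ∫⁻ p : ℝ × ℝ × ℝ, ‖F p.1 p.2.1 p.2.2‖ₑ ∂halfSpace := by
  rw [lintegral_halfSpace (Continuous.measurable hF).enorm]
  refine (enorm_integral_le_lintegral_enorm _).trans (lintegral_mono fun x => ?_)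
  refine (enorm_integral_le_lintegral_enorm _).trans (lintegral_mono fun y => ?_)
  exact enorm_integral_le_lintegral_enorm _

theorem JCont.normSq_eq {f : ℝ → ℝ → ℝ → ℝ} (hf : JCont f) {t : ℝ} {n : ℕ}
    (hi : Integrable (fun p : ℝ × ℝ × ℝ => (thw t 1 p.2.2 * angR p.1 p.2.1 ^ n *
      f p.1 p.2.1 p.2.2) ^ 2) (volume.restrict {p : ℝ × ℝ × ℝ | 0 < p.2.2})) :
    normSq t n f = ENNReal.ofReal (L2w t 1 n f ^ 2) := by
  rw [volume_restrict_eq_halfSpace] at hi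
  have h := integral_halfSpace hi
  have h0 : 0 ≤ ∫ p : ℝ × ℝ × ℝ, (thw t 1 p.2.2 * angR p.1 p.2.1 ^ n *
      f p.1 p.2.1 p.2.2) ^ 2 ∂halfSpace := integral_nonneg fun p => sq_nonneg _
  rw [L2w, Real.sq_sqrt (h ▸ h0), ← h,
    ofReal_integral_eq_lintegral_ofReal hi (.of_forall fun p => sq_nonneg _)]
  have e (p : ℝ × ℝ × ℝ) : ENNReal.ofReal ((thw t 1 p.2.2 * angR p.1 p.2.1 ^ n *
      f p.1 p.2.1 p.2.2) ^ 2) = ‖thw t 1 p.2.2 * angR p.1 p.2.1 ^ n *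
      f p.1 p.2.1 p.2.2‖ₑ ^ 2 := by
    rw [Real.enorm_eq_ofReal_abs, ← ENNReal.ofReal_pow (abs_nonneg _), sq_abs]
  simp only [e]
  rw [lintegral_halfSpace ((hf.weighted t n).measurable.enorm.pow_const 2)]
  rfl

theorem thw_two (t z : ℝ) : thw t 2 z = thw t 1 z * thw t 1 z := by
  rw [thw, thw, ← Real.exp_add]; ring_nf

/-- The Cauchy–Schwarz inequality for the trilinear form of the transport term. -/
theorem lintegral_trilinear_sq_le {t : ℝ} {u v g : ℝ → ℝ → ℝ → ℝ} (hu : JCont u) (hv : JCont v)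
    (hg : JCont g) {m k : ℕ} {G : ℝ → ℝ → ENNReal}
    (hG : ∀ x y z, 0 < z → ‖angR x y ^ m * u x y z‖ₑ ^ 2 ≤ G x y) :
    (∫⁻ p : ℝ × ℝ × ℝ, ‖thw t 2 p.2.2 * angR p.1 p.2.1 ^ (2 * (m + k)) *
      (u p.1 p.2.1 p.2.2 * v p.1 p.2.1 p.2.2) * g p.1 p.2.1 p.2.2‖ₑ ∂halfSpace) ^ 2 ≤
      (∫⁻ x, ∫⁻ y, G x y * slice t k v x y) * normSq t (m + k) g := by
  have hcu : Continuous fun p : ℝ × ℝ × ℝ => angR p.1 p.2.1 ^ m * u p.1 p.2.1 p.2.2 :=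
    ((continuous_angR.comp (by fun_prop :
      Continuous fun p : ℝ × ℝ × ℝ => (p.1, p.2.1))).pow m).mul hu
  have hA : Measurable fun p : ℝ × ℝ × ℝ => ‖angR p.1 p.2.1 ^ m * u p.1 p.2.1 p.2.2‖ₑ *
      ‖thw t 1 p.2.2 * angR p.1 p.2.1 ^ k * v p.1 p.2.1 p.2.2‖ₑ :=
    hcu.measurable.enorm.mul (hv.weighted t k).measurable.enorm
  have hB := (hg.weighted t (m + k)).measurable.enorm
  have e (p : ℝ × ℝ × ℝ) : ‖thw t 2 p.2.2 * angR p.1 p.2.1 ^ (2 * (m + k)) *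
      (u p.1 p.2.1 p.2.2 * v p.1 p.2.1 p.2.2) * g p.1 p.2.1 p.2.2‖ₑ =
      ‖angR p.1 p.2.1 ^ m * u p.1 p.2.1 p.2.2‖ₑ *
      ‖thw t 1 p.2.2 * angR p.1 p.2.1 ^ k * v p.1 p.2.1 p.2.2‖ₑ *
      ‖thw t 1 p.2.2 * angR p.1 p.2.1 ^ (m + k) * g p.1 p.2.1 p.2.2‖ₑ := by
    rw [← enorm_mul, ← enorm_mul, thw_two]
    congr 1
    ring
  simp only [e]
  refine (lintegral_mul_sq_le _ hA.aemeasurable hB.aemeasurable).trans ?_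
  rw [lintegral_halfSpace (hA.pow_const 2), lintegral_halfSpace (hB.pow_const 2)]
  refine mul_le_mul_left (lintegral_mono fun x => lintegral_mono fun y => ?_) _
  have hm : Measurable fun z => ‖thw t 1 z * angR x y ^ k * v x y z‖ₑ ^ 2 :=
    ((hv.weighted t k).comp (by fun_prop :
      Continuous fun z : ℝ => (x, y, z))).measurable.enorm.pow_const 2
  rw [slice, ← lintegral_const_mul _ hm]
  refine setLIntegral_mono' measurableSet_Ioi fun z hz => ?_
  rw [mul_pow]
  exact mul_le_mul_left (hG x y z hz) _


/-- The Sobolev combination bounding the supremum in `(x, y)` of a derivative of order `(i, j)`. -/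
def quad (a : ℕ → ℕ → ℝ) (i j : ℕ) : ℝ :=
  2 * (a i j + a (i + 1) j + a i (j + 1) + a (i + 1) (j + 1))

/-- The combination bounding the `∂_x^i ∂_y^j`-derivative of the vertical velocity. -/
def lin (a : ℕ → ℕ → ℝ) (i j : ℕ) : ℝ := a (i + 1) j + a i (j + 1) + ((i : ℝ) + j + 2) * a i j

theorem quad_nonneg {a : ℕ → ℕ → ℝ} (ha : ∀ i j, 0 ≤ a i j) (i j : ℕ) : 0 ≤ quad a i j := by
  have := ha i j; have := ha (i + 1) j; have := ha i (j + 1); have := ha (i + 1) (j + 1)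
  unfold quad; positivity

theorem lin_nonneg {a : ℕ → ℕ → ℝ} (ha : ∀ i j, 0 ≤ a i j) (i j : ℕ) : 0 ≤ lin a i j := by
  have := ha i j; have := ha (i + 1) j; have := ha i (j + 1)
  unfold lin; positivity

theorem IsTower.slice_le_quad {U : ℕ → ℕ → ℝ → ℝ → ℝ → ℝ} (hU : IsTower U) {t : ℝ}
    {a : ℕ → ℕ → ℝ} (ha : ∀ i j, 0 ≤ a i j)
    (h : ∀ i j, normSq t (i + j) (U i j) = ENNReal.ofReal (a i j ^ 2)) (i j : ℕ) (x y : ℝ) :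
    slice t (i + j) (U i j) x y ≤ ENNReal.ofReal (quad a i j ^ 2) := by
  refine (hU.slice_le t i j x y).trans ?_
  rw [h i j, h (i + 1) j, h i (j + 1), h (i + 1) (j + 1),
    ← ENNReal.ofReal_add (by positivity) (by positivity),
    ← ENNReal.ofReal_add (by positivity) (by positivity),
    ← ENNReal.ofReal_add (by positivity) (by positivity),
    ← ENNReal.ofReal_ofNat, ← ENNReal.ofReal_mul (by norm_num)]
  refine ENNReal.ofReal_le_ofReal ?_
  have h1 := ha i j; have h2 := ha (i + 1) j; have h3 := ha i (j + 1)
  have h4 := ha (i + 1) (j + 1)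
  unfold quad
  nlinarith [mul_nonneg h1 h2, mul_nonneg h1 h3, mul_nonneg h1 h4, mul_nonneg h2 h3,
    mul_nonneg h2 h4, mul_nonneg h3 h4]

theorem ofReal_lin_sq_ge {a : ℕ → ℕ → ℝ} (ha : ∀ i j, 0 ≤ a i j) (i j : ℕ) :
    ENNReal.ofReal (a (i + 1) j ^ 2) + ENNReal.ofReal (a i (j + 1) ^ 2)
      + ENNReal.ofReal (((i : ℝ) + j + 2) ^ 2) * ENNReal.ofReal (a i j ^ 2) ≤
      ENNReal.ofReal (lin a i j ^ 2) := by
  rw [← ENNReal.ofReal_mul (by positivity), ← ENNReal.ofReal_add (by positivity) (by positivity),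
    ← ENNReal.ofReal_add (by positivity) (by positivity)]
  refine ENNReal.ofReal_le_ofReal ?_
  have h1 := ha (i + 1) j
  have h2 := ha i (j + 1)
  have h3 : 0 ≤ ((i : ℝ) + j + 2) * a i j := mul_nonneg (by positivity) (ha i j)
  rw [← mul_pow, lin]
  nlinarith [mul_nonneg h1 h2, mul_nonneg h1 h3, mul_nonneg h2 h3]

theorem velSq_le {U : ℕ → ℕ → ℝ → ℝ → ℝ → ℝ} {t : ℝ} {c : ℕ → ℕ → ℝ} (hc : ∀ i j, 0 ≤ c i j)
    {x y : ℝ} (h : ∀ i j, slice t (i + j) (U i j) x y ≤ ENNReal.ofReal (c i j ^ 2)) (i j : ℕ) :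
    velSq t U i j x y ≤ ENNReal.ofReal (lin c i j ^ 2) :=
  (add_le_add (add_le_add (h (i + 1) j) (h i (j + 1))) (mul_le_mul_right (h i j) _)).trans
    (ofReal_lin_sq_ge hc i j)

theorem JCont.normSq_eq_lintegral {f : ℝ → ℝ → ℝ → ℝ} (hf : JCont f) (t : ℝ) (k : ℕ) :
    normSq t k f = ∫⁻ p : ℝ × ℝ, slice t k f p.1 p.2 := by
  rw [Measure.volume_eq_prod, lintegral_prod _ (hf.measurable_slice t k).aemeasurable]
  rfl

theorem IsTower.lintegral_velSq_le {U : ℕ → ℕ → ℝ → ℝ → ℝ → ℝ} (hU : IsTower U) {t : ℝ}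
    {a : ℕ → ℕ → ℝ} (ha : ∀ i j, 0 ≤ a i j)
    (h : ∀ i j, normSq t (i + j) (U i j) = ENNReal.ofReal (a i j ^ 2)) (i j : ℕ) :
    ∫⁻ x, ∫⁻ y, velSq t U i j x y ≤ ENNReal.ofReal (lin a i j ^ 2) := by
  have m (k i j : ℕ) := (hU.cont i j).measurable_slice t k
  have e : ∫⁻ x, ∫⁻ y, velSq t U i j x y = ∫⁻ p : ℝ × ℝ, velSq t U i j p.1 p.2 := by
    rw [Measure.volume_eq_prod]
    exact (lintegral_prod (fun p : ℝ × ℝ => velSq t U i j p.1 p.2)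
      (((m _ _ _).add (m _ _ _)).add ((m _ _ _).const_mul _)).aemeasurable).symm
  rw [e]
  refine le_trans (le_of_eq ?_) (ofReal_lin_sq_ge ha i j)
  unfold velSq
  rw [lintegral_add_left ((m _ _ _).fun_add (m _ _ _)), lintegral_add_left (m _ _ _),
    lintegral_const_mul' _ _ ENNReal.ofReal_ne_top, ← (hU.cont _ _).normSq_eq_lintegral,
    ← (hU.cont _ _).normSq_eq_lintegral, ← (hU.cont _ _).normSq_eq_lintegral, h, h, h]

theorem sqrt_eq_rpow_quarter_sq {T : ℝ} (hT : 0 ≤ T) : √T = (T ^ ((1 : ℝ) / 4)) ^ 2 := by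
  rw [← Real.rpow_natCast, ← Real.rpow_mul hT, Real.sqrt_eq_rpow]
  norm_num

/-- The bound for the product of the `(i, j)`-derivative of the velocity and the
`(k, l)`-derivative of the transported function: the factor of lower order is estimated in
`L^∞_h`. -/
def transportBound (a d : ℕ → ℕ → ℝ) (i j k l : ℕ) : ℝ :=
  if i + j ≤ k + l then lin (quad a) i j * d k l else lin a i j * quad d k l

theorem transportBound_nonneg {a d : ℕ → ℕ → ℝ} (ha : ∀ i j, 0 ≤ a i j) (hd : ∀ i j, 0 ≤ d i j)
    (i j k l : ℕ) : 0 ≤ transportBound a d i j k l := by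
  unfold transportBound
  split_ifs
  · exact mul_nonneg (lin_nonneg (quad_nonneg ha) i j) (hd k l)
  · exact mul_nonneg (lin_nonneg ha i j) (quad_nonneg hd k l)

theorem IsTower.lintegral_velSq_mul_slice_le {U V : ℕ → ℕ → ℝ → ℝ → ℝ → ℝ} (hU : IsTower U)
    (hV : IsTower V) {t : ℝ} {a d : ℕ → ℕ → ℝ} (ha : ∀ i j, 0 ≤ a i j) (hd : ∀ i j, 0 ≤ d i j)
    (hUa : ∀ i j, normSq t (i + j) (U i j) = ENNReal.ofReal (a i j ^ 2))
    (hVd : ∀ i j, normSq t (i + j) (V i j) = ENNReal.ofReal (d i j ^ 2)) (i j k l : ℕ) :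
    ∫⁻ x, ∫⁻ y, velSq t U i j x y * slice t (k + l) (V k l) x y ≤
      ENNReal.ofReal (transportBound a d i j k l ^ 2) := by
  unfold transportBound
  split_ifs
  · rw [mul_pow, ENNReal.ofReal_mul (by positivity), ← hVd, normSq,
      ← lintegral_const_mul' _ _ ENNReal.ofReal_ne_top]
    refine lintegral_mono fun x => ?_
    rw [← lintegral_const_mul' _ _ ENNReal.ofReal_ne_top]
    exact lintegral_mono fun y => mul_le_mul_left
      (velSq_le (quad_nonneg ha) (fun i j => hU.slice_le_quad ha hUa i j x y) i j) _
  · rw [mul_pow, ENNReal.ofReal_mul (by positivity)]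
    refine le_trans ?_ (mul_le_mul_left (hU.lintegral_velSq_le ha hUa i j) _)
    rw [← lintegral_mul_const' _ _ ENNReal.ofReal_ne_top]
    refine lintegral_mono fun x => ?_
    rw [← lintegral_mul_const' _ _ ENNReal.ofReal_ne_top]
    exact lintegral_mono fun y => mul_le_mul_right (hV.slice_le_quad hd hVd k l x y) _

theorem IsTower.lintegral_transport_le {U V : ℕ → ℕ → ℝ → ℝ → ℝ → ℝ} (hU : IsTower U)
    (hV : IsTower V) {t : ℝ} (ht : 0 ≤ t) {a d : ℕ → ℕ → ℝ} (ha : ∀ i j, 0 ≤ a i j)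
    (hd : ∀ i j, 0 ≤ d i j)
    (hUa : ∀ i j, normSq t (i + j) (U i j) = ENNReal.ofReal (a i j ^ 2))
    (hVd : ∀ i j, normSq t (i + j) (V i j) = ENNReal.ofReal (d i j ^ 2)) (i j k l : ℕ)
    {f : ℝ → ℝ → ℝ → ℝ} (hf : JCont f) {w : ℝ} (hw : 0 ≤ w)
    (hfw : normSq t (i + j + (k + l)) f = ENNReal.ofReal (w ^ 2)) :
    ∫⁻ p : ℝ × ℝ × ℝ, ‖thw t 2 p.2.2 * angR p.1 p.2.1 ^ (2 * (i + j + (k + l))) *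
      (_root_.scalTower (fun i j => _root_.phiF t (U i j)) i j p.1 p.2.1 p.2.2 *
        V k l p.1 p.2.1 p.2.2) * f p.1 p.2.1 p.2.2‖ₑ ∂halfSpace ≤
      ENNReal.ofReal (4 * angT t ^ ((1 : ℝ) / 4) * transportBound a d i j k l * w) := by
  have hT : 0 ≤ angT t := by unfold angT; linarith
  have hB := transportBound_nonneg ha hd i j k l
  refine (ENNReal.pow_le_pow_left_iff two_ne_zero).1 ?_
  refine (lintegral_trilinear_sq_le ((hU.phiF t).scalTower.cont i j) (hV.cont k l) hf
    fun x y z hz => hU.enorm_scalTower_sq_le ht i j x y hz).trans ?_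
  simp only [mul_assoc (ENNReal.ofReal (16 * √(angT t))),
    lintegral_const_mul' _ _ ENNReal.ofReal_ne_top]
  rw [hfw, ← mul_assoc, ← ENNReal.ofReal_pow (by positivity), mul_pow (4 * angT t ^ ((1 : ℝ) / 4) * _) w,
    ENNReal.ofReal_mul (q := w ^ 2) (by positivity)]
  refine mul_le_mul_left ?_ _
  rw [mul_pow, ENNReal.ofReal_mul (q := transportBound a d i j k l ^ 2) (by positivity), mul_pow,
    ← sqrt_eq_rpow_quarter_sq hT, show (4 : ℝ) ^ 2 = 16 by norm_num]
  exact mul_le_mul_right (hU.lintegral_velSq_mul_slice_le hV ha hd hUa hVd i j k l) _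

theorem abs_I2_le {t : ℝ} (ht : 0 ≤ t) {g : ℝ → ℝ → ℝ → ℝ} (hg : Smooth3 g) (h1 : L2cond t g)
    (h2 : L2condZ t g) (α β : ℕ) :
    |I2 t g α β| ≤ ∑ p ∈ Finset.HasAntidiagonal.antidiagonal α,
      ∑ q ∈ Finset.HasAntidiagonal.antidiagonal β, (α.choose p.1 : ℝ) * (β.choose q.1) *
        (4 * angT t ^ ((1 : ℝ) / 4) * transportBound (fun i j => L2w t 1 (i + j) (pdh i j g))
          (fun i j => L2w t 1 (i + j) (pdh i j (pdz g))) p.1 q.1 p.2 q.2 *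
          L2w t 1 (α + β) (pdh α β g)) := by
  have hT : 0 ≤ angT t := by unfold angT; linarith
  have hU := hg.isTower
  have hV := hg.pdz.isTower
  set a := fun i j => L2w t 1 (i + j) (pdh i j g)
  set d := fun i j => L2w t 1 (i + j) (pdh i j (pdz g))
  have ha : ∀ i j, 0 ≤ a i j := fun i j => Real.sqrt_nonneg _
  have hd : ∀ i j, 0 ≤ d i j := fun i j => Real.sqrt_nonneg _
  have hUa : ∀ i j, normSq t (i + j) (pdh i j g) = ENNReal.ofReal (a i j ^ 2) :=
    fun i j => (hU.cont i j).normSq_eq (h1 i j)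
  have hVd : ∀ i j, normSq t (i + j) (pdh i j (pdz g)) = ENNReal.ofReal (d i j ^ 2) :=
    fun i j => (hV.cont i j).normSq_eq (h2 i j)
  set S := _root_.scalTower (fun i j => _root_.phiF t (pdh i j g)) with hS
  have hST : IsTower S := (hU.phiF t).scalTower
  have e : pdh α β (fun x y z => uzv t g x y z * pdz g x y z) =
      mulTower S (fun i j => pdh i j (pdz g)) α β := by
    rw [← hST.pdh_mul hV, hS, ← hU.uzv_eq t]
    rfl
  have hw := ha α β
  set w := a α β with hwd
  have hB := fun i j k l => transportBound_nonneg ha hd i j k l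
  have hnn : 0 ≤ ∑ p ∈ Finset.HasAntidiagonal.antidiagonal α,
      ∑ q ∈ Finset.HasAntidiagonal.antidiagonal β, (α.choose p.1 : ℝ) * (β.choose q.1) *
        (4 * angT t ^ ((1 : ℝ) / 4) * transportBound a d p.1 q.1 p.2 q.2 * w) :=
    Finset.sum_nonneg fun p _ => Finset.sum_nonneg fun q _ => by
      have := hB p.1 q.1 p.2 q.2
      positivity
  rw [← ENNReal.ofReal_le_ofReal_iff hnn, ← Real.enorm_eq_ofReal_abs, I2, enorm_neg, e]
  have hmul : IsTower (mulTower S fun i j => pdh i j (pdz g)) := hST.mulTower hV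
  have c1 := (continuous_thw t 2).comp (by fun_prop : Continuous fun p : ℝ × ℝ × ℝ => p.2.2)
  have c2 := continuous_angR.comp (by fun_prop : Continuous fun p : ℝ × ℝ × ℝ => (p.1, p.2.1))
  have cc : ∀ u : ℝ → ℝ → ℝ → ℝ, JCont u → JCont fun x y z =>
      thw t 2 z * angR x y ^ (2 * (α + β)) * u x y z * pdh α β g x y z := fun u hu =>
    ((c1.mul (c2.pow _)).mul hu).mul (hU.cont α β)
  refine (enorm_trip_le (cc _ (hmul.cont α β))).trans ?_
  rw [ENNReal.ofReal_sum_of_nonneg fun p _ => Finset.sum_nonneg fun q _ => by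
      have := hB p.1 q.1 p.2 q.2
      positivity]
  have hm (p q : ℕ × ℕ) : Measurable fun r : ℝ × ℝ × ℝ =>
      ‖thw t 2 r.2.2 * angR r.1 r.2.1 ^ (2 * (α + β)) *
        (S p.1 q.1 r.1 r.2.1 r.2.2 * pdh p.2 q.2 (pdz g) r.1 r.2.1 r.2.2) *
          pdh α β g r.1 r.2.1 r.2.2‖ₑ :=
    (cc (fun x y z => S p.1 q.1 x y z * pdh p.2 q.2 (pdz g) x y z)
      (Continuous.mul (hST.cont p.1 q.1) (hV.cont p.2 q.2))).measurable.enorm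
  calc _ ≤ ∫⁻ r : ℝ × ℝ × ℝ, (∑ p ∈ Finset.HasAntidiagonal.antidiagonal α,
      ∑ q ∈ Finset.HasAntidiagonal.antidiagonal β,
        ENNReal.ofReal ((α.choose p.1 : ℝ) * (β.choose q.1)) *
        ‖thw t 2 r.2.2 * angR r.1 r.2.1 ^ (2 * (α + β)) *
        (S p.1 q.1 r.1 r.2.1 r.2.2 * pdh p.2 q.2 (pdz g) r.1 r.2.1 r.2.2) *
          pdh α β g r.1 r.2.1 r.2.2‖ₑ) ∂halfSpace := by
        refine lintegral_mono fun r => ?_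
        simp only [mulTower, Finset.mul_sum, Finset.sum_mul]
        refine (enorm_sum_le _ _).trans (Finset.sum_le_sum fun p _ => ?_)
        refine (enorm_sum_le _ _).trans (Finset.sum_le_sum fun q _ => le_of_eq ?_)
        rw [← Real.enorm_of_nonneg (by positivity), ← enorm_mul]
        congr 1
        ring
    _ = ∑ p ∈ Finset.HasAntidiagonal.antidiagonal α,
      ∑ q ∈ Finset.HasAntidiagonal.antidiagonal β,
        ENNReal.ofReal ((α.choose p.1 : ℝ) * (β.choose q.1)) * ∫⁻ r : ℝ × ℝ × ℝ,
        ‖thw t 2 r.2.2 * angR r.1 r.2.1 ^ (2 * (α + β)) *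
        (S p.1 q.1 r.1 r.2.1 r.2.2 * pdh p.2 q.2 (pdz g) r.1 r.2.1 r.2.2) *
          pdh α β g r.1 r.2.1 r.2.2‖ₑ ∂halfSpace := by
        rw [lintegral_finsetSum _ fun p _ => Finset.measurable_fun_sum _ fun q _ =>
          (hm p q).const_mul _]
        refine Finset.sum_congr rfl fun p _ => ?_
        rw [lintegral_finsetSum _ fun q _ => (hm p q).const_mul _]
        exact Finset.sum_congr rfl fun q _ => lintegral_const_mul' _ _ ENNReal.ofReal_ne_top
    _ ≤ _ := by
        refine Finset.sum_le_sum fun p hp => ?_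
        rw [ENNReal.ofReal_sum_of_nonneg fun q _ => by
          have := hB p.1 q.1 p.2 q.2
          positivity]
        refine Finset.sum_le_sum fun q hq => ?_
        rw [ENNReal.ofReal_mul (q := _ * w) (by positivity)]
        refine mul_le_mul_right ?_ _
        have hs : α + β = p.1 + q.1 + (p.2 + q.2) := by
          rw [← Finset.HasAntidiagonal.mem_antidiagonal.1 hp,
            ← Finset.HasAntidiagonal.mem_antidiagonal.1 hq]
          ring
        have hfw := hUa α β
        rw [hs] at hfw ⊢
        exact hU.lintegral_transport_le hV ht ha hd hUa hVd p.1 q.1 p.2 q.2 (hU.cont α β) hw hfw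

/-- The sum of `a i j` over `i + j = n`. -/
def diag (a : ℕ → ℕ → ℝ) (n : ℕ) : ℝ := ∑ p ∈ Finset.HasAntidiagonal.antidiagonal n, a p.1 p.2

theorem diag_nonneg {a : ℕ → ℕ → ℝ} (ha : ∀ i j, 0 ≤ a i j) (n : ℕ) : 0 ≤ diag a n :=
  Finset.sum_nonneg fun p _ => ha p.1 p.2

theorem diag_succ_left_le {a : ℕ → ℕ → ℝ} (ha : ∀ i j, 0 ≤ a i j) (n : ℕ) :
    diag (fun i j => a (i + 1) j) n ≤ diag a (n + 1) := by
  rw [diag, diag, Finset.Nat.sum_antidiagonal_succ]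
  exact le_add_of_nonneg_left (ha 0 (n + 1))

theorem diag_succ_right_le {a : ℕ → ℕ → ℝ} (ha : ∀ i j, 0 ≤ a i j) (n : ℕ) :
    diag (fun i j => a i (j + 1)) n ≤ diag a (n + 1) := by
  rw [diag, diag, Finset.Nat.sum_antidiagonal_succ']
  exact le_add_of_nonneg_left (ha (n + 1) 0)

theorem diag_lin_le {a : ℕ → ℕ → ℝ} (ha : ∀ i j, 0 ≤ a i j) (n : ℕ) :
    diag (lin a) n ≤ 2 * diag a (n + 1) + ((n : ℝ) + 2) * diag a n := by
  have h : diag (lin a) n = diag (fun i j => a (i + 1) j) n + diag (fun i j => a i (j + 1)) n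
      + ((n : ℝ) + 2) * diag a n := by
    simp only [diag, lin, Finset.mul_sum, ← Finset.sum_add_distrib]
    refine Finset.sum_congr rfl fun p hp => ?_
    rw [← Finset.HasAntidiagonal.mem_antidiagonal.1 hp]
    push_cast
    ring
  have h1 := diag_succ_left_le ha n
  have h2 := diag_succ_right_le ha n
  linarith

theorem diag_quad_le {a : ℕ → ℕ → ℝ} (ha : ∀ i j, 0 ≤ a i j) (n : ℕ) :
    diag (quad a) n ≤ 2 * (diag a n + 2 * diag a (n + 1) + diag a (n + 2)) := by
  have h : diag (quad a) n = 2 * (diag a n + diag (fun i j => a (i + 1) j) n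
      + diag (fun i j => a i (j + 1)) n + diag (fun i j => a (i + 1) (j + 1)) n) := by
    simp only [diag, quad, Finset.mul_sum, ← Finset.sum_add_distrib]
  have h1 := diag_succ_left_le ha n
  have h2 := diag_succ_right_le ha n
  have h3 := diag_succ_left_le (a := fun i j => a i (j + 1)) (fun i j => ha i (j + 1)) n
  have h4 := diag_succ_right_le ha (n + 1)
  linarith

theorem choose_mul_choose_le (i j k l : ℕ) :
    (i + k).choose i * (j + l).choose j ≤ (i + j + (k + l)).choose (i + j) := by
  rw [show i + j + (k + l) = (i + k) + (j + l) by ring, Nat.add_choose_eq (i + k)]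
  exact Finset.single_le_sum
    (f := fun p : ℕ × ℕ => (i + k).choose p.1 * (j + l).choose p.2) (fun _ _ => Nat.zero_le _)
    (Finset.HasAntidiagonal.mem_antidiagonal.2 (rfl : (i, j).1 + (i, j).2 = i + j))

theorem sum_antidiagonal_exchange (F : ℕ → ℕ → ℕ → ℕ → ℝ) (n : ℕ) :
    ∑ p ∈ Finset.HasAntidiagonal.antidiagonal n,
      ∑ r ∈ Finset.HasAntidiagonal.antidiagonal p.1,
        ∑ s ∈ Finset.HasAntidiagonal.antidiagonal p.2, F r.1 s.1 r.2 s.2 =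
    ∑ q ∈ Finset.HasAntidiagonal.antidiagonal n,
      ∑ u ∈ Finset.HasAntidiagonal.antidiagonal q.1,
        ∑ v ∈ Finset.HasAntidiagonal.antidiagonal q.2, F u.1 u.2 v.1 v.2 := by
  simp only [← Finset.sum_product', Finset.sum_sigma']
  let e : (Σ _ : ℕ × ℕ, (ℕ × ℕ) × ℕ × ℕ) → Σ _ : ℕ × ℕ, (ℕ × ℕ) × ℕ × ℕ := fun x =>
    ⟨(x.2.1.1 + x.2.2.1, x.2.1.2 + x.2.2.2), ((x.2.1.1, x.2.2.1), (x.2.1.2, x.2.2.2))⟩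
  refine Finset.sum_nbij' e e ?_ ?_ ?_ ?_ ?_
  all_goals
    rintro ⟨⟨p, q⟩, ⟨i, j⟩, k, l⟩ h
    simp only [Finset.mem_sigma, Finset.mem_product, Finset.HasAntidiagonal.mem_antidiagonal, e]
      at h ⊢
  · exact ⟨by omega, trivial, trivial⟩
  · exact ⟨by omega, trivial, trivial⟩
  · obtain ⟨-, rfl, rfl⟩ := h; rfl
  · obtain ⟨-, rfl, rfl⟩ := h; rfl

theorem sum_choose_mul_choose_le {B : ℕ → ℕ → ℕ → ℕ → ℝ} (hB : ∀ i j k l, 0 ≤ B i j k l)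
    (n : ℕ) :
    ∑ p ∈ Finset.HasAntidiagonal.antidiagonal n,
      ∑ r ∈ Finset.HasAntidiagonal.antidiagonal p.1,
        ∑ s ∈ Finset.HasAntidiagonal.antidiagonal p.2,
          (p.1.choose r.1 : ℝ) * (p.2.choose s.1) * B r.1 s.1 r.2 s.2 ≤
    ∑ q ∈ Finset.HasAntidiagonal.antidiagonal n, (n.choose q.1 : ℝ) *
      ∑ u ∈ Finset.HasAntidiagonal.antidiagonal q.1,
        ∑ v ∈ Finset.HasAntidiagonal.antidiagonal q.2, B u.1 u.2 v.1 v.2 := by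
  calc _ ≤ ∑ p ∈ Finset.HasAntidiagonal.antidiagonal n,
      ∑ r ∈ Finset.HasAntidiagonal.antidiagonal p.1,
        ∑ s ∈ Finset.HasAntidiagonal.antidiagonal p.2,
          (n.choose (r.1 + s.1) : ℝ) * B r.1 s.1 r.2 s.2 := by
        refine Finset.sum_le_sum fun p hp => Finset.sum_le_sum fun r hr =>
          Finset.sum_le_sum fun s hs => mul_le_mul_of_nonneg_right ?_ (hB _ _ _ _)
        rw [Finset.HasAntidiagonal.mem_antidiagonal] at hp hr hs
        rw [← hp, ← hr, ← hs, add_add_add_comm]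
        exact_mod_cast choose_mul_choose_le r.1 s.1 r.2 s.2
    _ = ∑ q ∈ Finset.HasAntidiagonal.antidiagonal n,
      ∑ u ∈ Finset.HasAntidiagonal.antidiagonal q.1,
        ∑ v ∈ Finset.HasAntidiagonal.antidiagonal q.2,
          (n.choose (u.1 + u.2) : ℝ) * B u.1 u.2 v.1 v.2 :=
        sum_antidiagonal_exchange (fun i j k l => (n.choose (i + j) : ℝ) * B i j k l) n
    _ = _ := by
        simp only [Finset.mul_sum]
        refine Finset.sum_congr rfl fun q _ => Finset.sum_congr rfl fun u hu => ?_
        rw [Finset.HasAntidiagonal.mem_antidiagonal.1 hu]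

theorem sum_transportBound (a d : ℕ → ℕ → ℝ) (m k : ℕ) :
    ∑ u ∈ Finset.HasAntidiagonal.antidiagonal m, ∑ v ∈ Finset.HasAntidiagonal.antidiagonal k,
      transportBound a d u.1 u.2 v.1 v.2 =
    if m ≤ k then diag (lin (quad a)) m * diag d k else diag (lin a) m * diag (quad d) k := by
  have h : ∀ u ∈ Finset.HasAntidiagonal.antidiagonal m,
      ∀ v ∈ Finset.HasAntidiagonal.antidiagonal k, transportBound a d u.1 u.2 v.1 v.2 =
        if m ≤ k then lin (quad a) u.1 u.2 * d v.1 v.2 else lin a u.1 u.2 * quad d v.1 v.2 := by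
    intro u hu v hv
    rw [transportBound, Finset.HasAntidiagonal.mem_antidiagonal.1 hu,
      Finset.HasAntidiagonal.mem_antidiagonal.1 hv]
  rw [Finset.sum_congr rfl fun u hu => Finset.sum_congr rfl (h u hu)]
  split_ifs <;> simp only [diag, Finset.sum_mul_sum]

theorem sum_range_sum_antidiagonal_le {p q : ℕ → ℝ} (hp : ∀ n, 0 ≤ p n) (hq : ∀ n, 0 ≤ q n)
    (N : ℕ) :
    ∑ n ∈ Finset.range N, ∑ x ∈ Finset.HasAntidiagonal.antidiagonal n, p x.1 * q x.2 ≤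
      (∑ m ∈ Finset.range N, p m) * ∑ k ∈ Finset.range N, q k := by
  have h0 : ∀ x : ℕ × ℕ, 0 ≤ p x.1 * q x.2 := fun x => mul_nonneg (hp _) (hq _)
  rw [Finset.sum_mul_sum, ← Finset.sum_product']
  refine le_trans (le_of_eq ?_) (Finset.sum_fiberwise_le_sum_of_sum_fiber_nonneg
    (t := Finset.range N) (g := fun x : ℕ × ℕ => x.1 + x.2)
    fun n _ => Finset.sum_nonneg fun x _ => h0 x)
  refine Finset.sum_congr rfl fun n hn => Finset.sum_congr ?_ fun _ _ => rfl
  ext x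
  simp only [Finset.HasAntidiagonal.mem_antidiagonal, Finset.mem_filter, Finset.mem_product,
    Finset.mem_range] at hn ⊢
  omega

theorem Summable.sum_range_add_le_tsum {f : ℕ → ℝ} (hf : Summable f) (h0 : ∀ n, 0 ≤ f n)
    (N s : ℕ) : ∑ m ∈ Finset.range N, f (m + s) ≤ ∑' n, f n := by
  have h := hf.sum_le_tsum ((Finset.range N).map (addRightEmbedding s)) fun n _ => h0 n
  rwa [Finset.sum_map] at h

theorem Mfac_pos (n : ℕ) : 0 < Mfac n := by unfold Mfac; positivity

theorem Mfac_mul_choose {n : ℕ} {q : ℕ × ℕ} (hq : q ∈ Finset.HasAntidiagonal.antidiagonal n) :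
    Mfac n * n.choose q.1 = ((n : ℝ) + 1) ^ 4 / (q.1.factorial * q.2.factorial) := by
  rw [← Finset.HasAntidiagonal.mem_antidiagonal.1 hq, Nat.cast_add_choose, Mfac]
  push_cast
  field_simp

section Sequences

variable {A : ℕ → ℝ} {τ : ℝ}

theorem low_order_term_le (hA : ∀ n, 0 ≤ A n) (hτ : 0 < τ) (m : ℕ) :
    τ ^ m / m.factorial * (((m : ℝ) + 2) * A m + (2 * m + 6) * A (m + 1) + (m + 6) * A (m + 2)
      + 2 * A (m + 3)) ≤
    2 * (A m * τ ^ m * Mfac m) + τ⁻¹ * (A (m + 1) * τ ^ (m + 1) * Mfac (m + 1))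
      + (τ ^ 2)⁻¹ * (A (m + 2) * τ ^ (m + 2) * Mfac (m + 2))
      + (τ ^ 2)⁻¹ * (A (m + 3) * τ ^ (m + 2) * ((m + 3 : ℕ) : ℝ) * Mfac (m + 3)) := by
  have hm : (0 : ℝ) ≤ m := m.cast_nonneg
  have hF : (0 : ℝ) < m.factorial := by positivity
  have key : ∀ {u c v : ℝ}, 0 ≤ u → c ≤ v → τ ^ m / m.factorial * (c * u) ≤
      τ ^ m / m.factorial * (v * u) := fun hu hcv => by gcongr
  have e0 : 2 * (A m * τ ^ m * Mfac m) = τ ^ m / m.factorial * (2 * ((m : ℝ) + 1) ^ 4 * A m) := by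
    rw [Mfac]; field_simp
  have e1 : τ⁻¹ * (A (m + 1) * τ ^ (m + 1) * Mfac (m + 1)) =
      τ ^ m / m.factorial * (((m : ℝ) + 2) ^ 4 / (m + 1) * A (m + 1)) := by
    rw [Mfac, Nat.factorial_succ]; push_cast; field_simp; ring
  have e2 : (τ ^ 2)⁻¹ * (A (m + 2) * τ ^ (m + 2) * Mfac (m + 2)) =
      τ ^ m / m.factorial * (((m : ℝ) + 3) ^ 4 / ((m + 1) * (m + 2)) * A (m + 2)) := by
    rw [Mfac, Nat.factorial_succ, Nat.factorial_succ]; push_cast; field_simp; ring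
  have e3 : (τ ^ 2)⁻¹ * (A (m + 3) * τ ^ (m + 2) * ((m + 3 : ℕ) : ℝ) * Mfac (m + 3)) =
      τ ^ m / m.factorial * (((m : ℝ) + 4) ^ 4 / ((m + 1) * (m + 2)) * A (m + 3)) := by
    rw [Mfac, Nat.factorial_succ, Nat.factorial_succ, Nat.factorial_succ]; push_cast
    field_simp; ring
  rw [e0, e1, e2, e3, ← mul_add, ← mul_add, ← mul_add]
  gcongr
  · exact hA m
  · nlinarith [pow_nonneg hm 2, pow_nonneg hm 3, pow_nonneg hm 4]
  · exact hA _
  · rw [le_div_iff₀ (by positivity)]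
    nlinarith [pow_nonneg hm 2, pow_nonneg hm 3, pow_nonneg hm 4]
  · exact hA _
  · rw [le_div_iff₀ (by positivity)]
    nlinarith [pow_nonneg hm 2, pow_nonneg hm 3, pow_nonneg hm 4]
  · exact hA _
  · rw [le_div_iff₀ (by positivity)]
    nlinarith [pow_nonneg hm 2, pow_nonneg hm 3, pow_nonneg hm 4]

theorem sup_term_le (hA : ∀ n, 0 ≤ A n) (hτ : 0 < τ) (m : ℕ) :
    τ ^ m / m.factorial * (A m + 2 * A (m + 1) + A (m + 2)) ≤
    A m * τ ^ m * Mfac m + 2 * τ⁻¹ * (A (m + 1) * τ ^ (m + 1) * Mfac (m + 1))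
      + (τ ^ 2)⁻¹ * (A (m + 2) * τ ^ (m + 2) * Mfac (m + 2)) := by
  have hm : (0 : ℝ) ≤ m := m.cast_nonneg
  have e0 : A m * τ ^ m * Mfac m = τ ^ m / m.factorial * (((m : ℝ) + 1) ^ 4 * A m) := by
    rw [Mfac]; field_simp
  have e1 : 2 * τ⁻¹ * (A (m + 1) * τ ^ (m + 1) * Mfac (m + 1)) =
      τ ^ m / m.factorial * (2 * (((m : ℝ) + 2) ^ 4 / (m + 1)) * A (m + 1)) := by
    rw [Mfac, Nat.factorial_succ]; push_cast; field_simp; ring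
  have e2 : (τ ^ 2)⁻¹ * (A (m + 2) * τ ^ (m + 2) * Mfac (m + 2)) =
      τ ^ m / m.factorial * (((m : ℝ) + 3) ^ 4 / ((m + 1) * (m + 2)) * A (m + 2)) := by
    rw [Mfac, Nat.factorial_succ, Nat.factorial_succ]; push_cast; field_simp; ring
  rw [e0, e1, e2, ← mul_add, ← mul_add]
  gcongr
  · exact le_mul_of_one_le_left (hA m) (one_le_pow₀ (by linarith))
  · exact hA _
  · refine le_mul_of_one_le_right (by norm_num) ?_
    rw [le_div_iff₀ (by positivity)]
    nlinarith [pow_nonneg hm 2, pow_nonneg hm 3, pow_nonneg hm 4]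
  · refine le_mul_of_one_le_left (hA _) ?_
    rw [le_div_iff₀ (by positivity)]
    nlinarith [pow_nonneg hm 2, pow_nonneg hm 3, pow_nonneg hm 4]

theorem high_order_term_le (hA : ∀ n, 0 ≤ A n) (hτ : 0 < τ) (m : ℕ) :
    τ ^ m * Mfac m * (2 * A (m + 1) + ((m : ℝ) + 2) * A m) ≤
    2 * (A m * τ ^ m * Mfac m) + τ * (A m * τ ^ (m - 1) * m * Mfac m)
      + 2 * (A (m + 1) * τ ^ m * ((m + 1 : ℕ) : ℝ) * Mfac (m + 1)) := by
  have e1 : τ * (A m * τ ^ (m - 1) * m * Mfac m) = τ ^ m * Mfac m * (m * A m) := by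
    rcases m with _ | m
    · simp
    · rw [Nat.add_sub_cancel]; ring
  have h2 : Mfac m ≤ ((m + 1 : ℕ) : ℝ) * Mfac (m + 1) := by
    rw [Mfac, Mfac, Nat.factorial_succ]
    push_cast
    rw [mul_div_assoc', mul_div_mul_left _ _ (by positivity)]
    gcongr
    linarith
  have h3 := mul_le_mul_of_nonneg_left h2 (mul_nonneg (hA (m + 1)) (pow_nonneg hτ.le m))
  rw [e1]
  linarith

end Sequences

theorem sum_low_order_le {A : ℕ → ℝ} {τ : ℝ} (hA : ∀ n, 0 ≤ A n) (hτ : 0 < τ)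
    (hX : Summable fun n => A n * τ ^ n * Mfac n)
    (hY : Summable fun n => A n * τ ^ (n - 1) * n * Mfac n) (N : ℕ) :
    ∑ m ∈ Finset.range N, τ ^ m / m.factorial * (((m : ℝ) + 2) * A m + (2 * m + 6) * A (m + 1)
      + (m + 6) * A (m + 2) + 2 * A (m + 3)) ≤
    2 * (1 + τ) ^ 2 / τ ^ 2 * (∑' n, A n * τ ^ n * Mfac n + ∑' n, A n * τ ^ (n - 1) * n * Mfac n) := by
  have hM := Mfac_pos
  have hX0 : ∀ n, 0 ≤ A n * τ ^ n * Mfac n := fun n => by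
    have := hA n; have := hM n; positivity
  have hY0 : ∀ n : ℕ, 0 ≤ A n * τ ^ (n - 1) * n * Mfac n := fun n => by
    have := hA n; have := hM n; positivity
  refine (Finset.sum_le_sum fun m _ => low_order_term_le hA hτ m).trans ?_
  simp only [Finset.sum_add_distrib, ← Finset.mul_sum]
  have x0 := hX.sum_range_add_le_tsum hX0 N 0
  have x1 := hX.sum_range_add_le_tsum hX0 N 1
  have x2 := hX.sum_range_add_le_tsum hX0 N 2
  have y3 := hY.sum_range_add_le_tsum hY0 N 3
  simp only [add_zero, show ∀ m : ℕ, m + 3 - 1 = m + 2 from fun _ => rfl] at x0 y3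
  set X := ∑' n, A n * τ ^ n * Mfac n
  set Y := ∑' n, A n * τ ^ (n - 1) * n * Mfac n
  have hXn : 0 ≤ X := tsum_nonneg hX0
  have hYn : 0 ≤ Y := tsum_nonneg hY0
  calc _ ≤ 2 * X + τ⁻¹ * X + (τ ^ 2)⁻¹ * X + (τ ^ 2)⁻¹ * Y := by gcongr
    _ = ((2 * τ ^ 2 + τ + 1) * X + Y) / τ ^ 2 := by field_simp
    _ ≤ 2 * (1 + τ) ^ 2 * (X + Y) / τ ^ 2 := by
        gcongr
        nlinarith [mul_nonneg hτ.le hXn, mul_nonneg hτ.le hYn,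
          mul_nonneg (mul_nonneg hτ.le hτ.le) hYn]
    _ = _ := by ring

theorem sum_sup_le {A : ℕ → ℝ} {τ : ℝ} (hA : ∀ n, 0 ≤ A n) (hτ : 0 < τ)
    (hX : Summable fun n => A n * τ ^ n * Mfac n) (N : ℕ) :
    ∑ m ∈ Finset.range N, τ ^ m / m.factorial * (A m + 2 * A (m + 1) + A (m + 2)) ≤
    (1 + τ) ^ 2 / τ ^ 2 * ∑' n, A n * τ ^ n * Mfac n := by
  have hX0 : ∀ n, 0 ≤ A n * τ ^ n * Mfac n := fun n => by
    have := hA n; have := Mfac_pos n; positivity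
  refine (Finset.sum_le_sum fun m _ => sup_term_le hA hτ m).trans ?_
  simp only [Finset.sum_add_distrib, ← Finset.mul_sum]
  have x0 := hX.sum_range_add_le_tsum hX0 N 0
  have x1 := hX.sum_range_add_le_tsum hX0 N 1
  have x2 := hX.sum_range_add_le_tsum hX0 N 2
  simp only [add_zero] at x0
  set X := ∑' n, A n * τ ^ n * Mfac n
  calc _ ≤ X + 2 * τ⁻¹ * X + (τ ^ 2)⁻¹ * X := by gcongr
    _ = _ := by field_simp; ring

theorem sum_high_order_le {A : ℕ → ℝ} {τ : ℝ} (hA : ∀ n, 0 ≤ A n) (hτ : 0 < τ)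
    (hX : Summable fun n => A n * τ ^ n * Mfac n)
    (hY : Summable fun n => A n * τ ^ (n - 1) * n * Mfac n) (N : ℕ) :
    ∑ m ∈ Finset.range N, τ ^ m * Mfac m * (2 * A (m + 1) + ((m : ℝ) + 2) * A m) ≤
    2 * (1 + τ) * (∑' n, A n * τ ^ n * Mfac n + ∑' n, A n * τ ^ (n - 1) * n * Mfac n) := by
  have hM := Mfac_pos
  have hX0 : ∀ n, 0 ≤ A n * τ ^ n * Mfac n := fun n => by
    have := hA n; have := hM n; positivity
  have hY0 : ∀ n : ℕ, 0 ≤ A n * τ ^ (n - 1) * n * Mfac n := fun n => by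
    have := hA n; have := hM n; positivity
  refine (Finset.sum_le_sum fun m _ => high_order_term_le hA hτ m).trans ?_
  simp only [Finset.sum_add_distrib, ← Finset.mul_sum]
  have x0 := hX.sum_range_add_le_tsum hX0 N 0
  have y0 := hY.sum_range_add_le_tsum hY0 N 0
  have y1 := hY.sum_range_add_le_tsum hY0 N 1
  simp only [add_zero, Nat.add_sub_cancel] at x0 y0 y1
  set X := ∑' n, A n * τ ^ n * Mfac n
  set Y := ∑' n, A n * τ ^ (n - 1) * n * Mfac n
  have hXn : 0 ≤ X := tsum_nonneg hX0
  have hYn : 0 ≤ Y := tsum_nonneg hY0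
  calc _ ≤ 2 * X + τ * Y + 2 * Y := by gcongr
    _ ≤ _ := by nlinarith [mul_nonneg hτ.le hXn, mul_nonneg hτ.le hYn]

theorem add_one_pow_four_le {m k n : ℕ} (h : m + k = n) (hmk : m ≤ k) :
    ((n : ℝ) + 1) ^ 4 ≤ 16 * ((k : ℝ) + 1) ^ 4 := by
  have h1 : (n : ℝ) + 1 ≤ 2 * ((k : ℝ) + 1) := by
    rw [← h]
    push_cast
    have : (m : ℝ) ≤ k := by exact_mod_cast hmk
    linarith
  calc _ ≤ (2 * ((k : ℝ) + 1)) ^ 4 := pow_le_pow_left₀ (by positivity) h1 4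
    _ = _ := by ring

theorem weighted_sum_transportBound_le {a d : ℕ → ℕ → ℝ} (ha : ∀ i j, 0 ≤ a i j)
    (hd : ∀ i j, 0 ≤ d i j) {τ : ℝ} (hτ : 0 < τ) (n : ℕ) :
    τ ^ n * Mfac n * ∑ q ∈ Finset.HasAntidiagonal.antidiagonal n, (n.choose q.1 : ℝ) *
      ∑ u ∈ Finset.HasAntidiagonal.antidiagonal q.1, ∑ v ∈ Finset.HasAntidiagonal.antidiagonal q.2,
        transportBound a d u.1 u.2 v.1 v.2 ≤
    16 * ∑ q ∈ Finset.HasAntidiagonal.antidiagonal n,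
      (τ ^ q.1 / q.1.factorial * diag (lin (quad a)) q.1 * (diag d q.2 * τ ^ q.2 * Mfac q.2)
        + τ ^ q.1 * Mfac q.1 * diag (lin a) q.1 * (τ ^ q.2 / q.2.factorial * diag (quad d) q.2)) := by
  rw [Finset.mul_sum, Finset.mul_sum]
  refine Finset.sum_le_sum fun q hq => ?_
  have h1 := diag_nonneg (lin_nonneg (quad_nonneg ha)) q.1
  have h2 := diag_nonneg (lin_nonneg ha) q.1
  have h3 := diag_nonneg hd q.2
  have h4 := diag_nonneg (quad_nonneg hd) q.2
  have hM1 := Mfac_pos q.1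
  have hM2 := Mfac_pos q.2
  have hn := Finset.HasAntidiagonal.mem_antidiagonal.1 hq
  rw [sum_transportBound, mul_assoc, ← mul_assoc (Mfac n), Mfac_mul_choose hq,
    show τ ^ n = τ ^ q.1 * τ ^ q.2 by rw [← hn, pow_add]]
  split_ifs with h
  · refine le_trans ?_ (mul_le_mul_of_nonneg_left (le_add_of_nonneg_right (by positivity))
      (by norm_num))
    calc _ ≤ τ ^ q.1 * τ ^ q.2 * (16 * ((q.2 : ℝ) + 1) ^ 4 / (q.1.factorial * q.2.factorial) *
          (diag (lin (quad a)) q.1 * diag d q.2)) := by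
          gcongr
          exact add_one_pow_four_le hn h
      _ = _ := by rw [Mfac]; field_simp
  · refine le_trans ?_ (mul_le_mul_of_nonneg_left (le_add_of_nonneg_left (by positivity))
      (by norm_num))
    calc _ ≤ τ ^ q.1 * τ ^ q.2 * (16 * ((q.1 : ℝ) + 1) ^ 4 / (q.1.factorial * q.2.factorial) *
          (diag (lin a) q.1 * diag (quad d) q.2)) := by
          gcongr
          exact add_one_pow_four_le (by omega) (not_le.1 h).le
      _ = _ := by rw [Mfac]; field_simp

theorem sum_weighted_transportBound_le {a d : ℕ → ℕ → ℝ} (ha : ∀ i j, 0 ≤ a i j)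
    (hd : ∀ i j, 0 ≤ d i j) {τ : ℝ} (hτ : 0 < τ)
    (hX : Summable fun n => diag a n * τ ^ n * Mfac n)
    (hY : Summable fun n => diag a n * τ ^ (n - 1) * n * Mfac n)
    (hD : Summable fun n => diag d n * τ ^ n * Mfac n) (N : ℕ) :
    ∑ n ∈ Finset.range N, τ ^ n * Mfac n *
      ∑ q ∈ Finset.HasAntidiagonal.antidiagonal n, (n.choose q.1 : ℝ) *
        ∑ u ∈ Finset.HasAntidiagonal.antidiagonal q.1,
          ∑ v ∈ Finset.HasAntidiagonal.antidiagonal q.2, transportBound a d u.1 u.2 v.1 v.2 ≤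
    128 * (1 + τ) ^ 3 / τ ^ 2 *
      (∑' n, diag a n * τ ^ n * Mfac n + ∑' n, diag a n * τ ^ (n - 1) * n * Mfac n) *
        ∑' n, diag d n * τ ^ n * Mfac n := by
  have hA := diag_nonneg ha
  have hDd := diag_nonneg hd
  have hM := fun n => (Mfac_pos n).le
  have hX0 : ∀ n, 0 ≤ diag a n * τ ^ n * Mfac n := fun n =>
    mul_nonneg (mul_nonneg (hA n) (pow_nonneg hτ.le n)) (hM n)
  have hY0 : ∀ n : ℕ, 0 ≤ diag a n * τ ^ (n - 1) * n * Mfac n := fun n =>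
    mul_nonneg (mul_nonneg (mul_nonneg (hA n) (pow_nonneg hτ.le _)) n.cast_nonneg) (hM n)
  have hD0 : ∀ n, 0 ≤ diag d n * τ ^ n * Mfac n := fun n =>
    mul_nonneg (mul_nonneg (hDd n) (pow_nonneg hτ.le n)) (hM n)
  set p₁ := fun m : ℕ => τ ^ m / m.factorial * diag (lin (quad a)) m
  set q₁ := fun k : ℕ => diag d k * τ ^ k * Mfac k
  set p₂ := fun m : ℕ => τ ^ m * Mfac m * diag (lin a) m
  set q₂ := fun k : ℕ => τ ^ k / k.factorial * diag (quad d) k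
  have hp₁ : ∀ m, 0 ≤ p₁ m := fun m =>
    mul_nonneg (by positivity) (diag_nonneg (lin_nonneg (quad_nonneg ha)) m)
  have hp₂ : ∀ m, 0 ≤ p₂ m := fun m =>
    mul_nonneg (mul_nonneg (by positivity) (hM m)) (diag_nonneg (lin_nonneg ha) m)
  have hq₂ : ∀ m, 0 ≤ q₂ m := fun m =>
    mul_nonneg (by positivity) (diag_nonneg (quad_nonneg hd) m)
  set X := ∑' n, diag a n * τ ^ n * Mfac n
  set Y := ∑' n, diag a n * τ ^ (n - 1) * n * Mfac n
  have hXn : 0 ≤ X := tsum_nonneg hX0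
  have hYn : 0 ≤ Y := tsum_nonneg hY0
  have hDn : 0 ≤ ∑' n, q₁ n := tsum_nonneg hD0
  have b₁ : ∑ m ∈ Finset.range N, p₁ m ≤ 2 * (2 * (1 + τ) ^ 2 / τ ^ 2 * (X + Y)) := by
    refine le_trans ?_ (mul_le_mul_of_nonneg_left (sum_low_order_le hA hτ hX hY N) zero_le_two)
    rw [Finset.mul_sum]
    refine Finset.sum_le_sum fun m _ => ?_
    rw [mul_left_comm]
    refine mul_le_mul_of_nonneg_left ?_ (by positivity)
    have e1 := diag_lin_le (quad_nonneg ha) m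
    have e2 := diag_quad_le ha (m + 1)
    have e3 := mul_le_mul_of_nonneg_left (diag_quad_le ha m)
      (by positivity : (0 : ℝ) ≤ (m : ℝ) + 2)
    linarith
  have b₂ : ∑ m ∈ Finset.range N, p₂ m ≤ 2 * (1 + τ) * (X + Y) :=
    (Finset.sum_le_sum fun m _ => mul_le_mul_of_nonneg_left (diag_lin_le ha m)
      (mul_nonneg (by positivity) (hM m))).trans (sum_high_order_le hA hτ hX hY N)
  have c₁ : ∑ k ∈ Finset.range N, q₁ k ≤ ∑' n, q₁ n := hD.sum_le_tsum _ fun n _ => hD0 n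
  have c₂ : ∑ k ∈ Finset.range N, q₂ k ≤ 2 * ((1 + τ) ^ 2 / τ ^ 2 * ∑' n, q₁ n) := by
    refine le_trans ?_ (mul_le_mul_of_nonneg_left (sum_sup_le hDd hτ hD N) zero_le_two)
    rw [Finset.mul_sum]
    refine Finset.sum_le_sum fun m _ => ?_
    rw [mul_left_comm]
    exact mul_le_mul_of_nonneg_left (diag_quad_le hd m) (by positivity)
  calc _ ≤ ∑ n ∈ Finset.range N, 16 * ∑ q ∈ Finset.HasAntidiagonal.antidiagonal n,
          (p₁ q.1 * q₁ q.2 + p₂ q.1 * q₂ q.2) :=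
        Finset.sum_le_sum fun n _ => weighted_sum_transportBound_le ha hd hτ n
    _ = 16 * (∑ n ∈ Finset.range N, ∑ q ∈ Finset.HasAntidiagonal.antidiagonal n,
          p₁ q.1 * q₁ q.2 + ∑ n ∈ Finset.range N, ∑ q ∈ Finset.HasAntidiagonal.antidiagonal n,
          p₂ q.1 * q₂ q.2) := by
        simp only [← Finset.mul_sum, Finset.sum_add_distrib]
    _ ≤ 16 * ((∑ m ∈ Finset.range N, p₁ m) * ∑ k ∈ Finset.range N, q₁ k
          + (∑ m ∈ Finset.range N, p₂ m) * ∑ k ∈ Finset.range N, q₂ k) := by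
        gcongr
        · exact sum_range_sum_antidiagonal_le hp₁ hD0 N
        · exact sum_range_sum_antidiagonal_le hp₂ hq₂ N
    _ ≤ 16 * (2 * (2 * (1 + τ) ^ 2 / τ ^ 2 * (X + Y)) * ∑' n, q₁ n
          + 2 * (1 + τ) * (X + Y) * (2 * ((1 + τ) ^ 2 / τ ^ 2 * ∑' n, q₁ n))) := by
        gcongr
        · exact Finset.sum_nonneg fun k _ => hD0 k
        · exact Finset.sum_nonneg fun k _ => hq₂ k
    _ = (64 * (1 + τ) ^ 2 + 64 * (1 + τ) ^ 3) / τ ^ 2 * (X + Y) * ∑' n, q₁ n := by ring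
    _ ≤ _ := by
        gcongr
        nlinarith [pow_nonneg hτ.le 2, pow_nonneg hτ.le 3]

theorem sum_range_pdh_eq_diag (t : ℝ) (g : ℝ → ℝ → ℝ → ℝ) (n : ℕ) :
    ∑ a ∈ Finset.range (n + 1), L2w t 1 n (pdh a (n - a) g) =
      diag (fun i j => L2w t 1 (i + j) (pdh i j g)) n := by
  rw [diag, Finset.Nat.sum_antidiagonal_eq_sum_range_succ
    (fun i j => L2w t 1 (i + j) (pdh i j g))]
  refine Finset.sum_congr rfl fun a ha => ?_
  rw [Nat.add_sub_cancel' (Nat.lt_succ_iff.1 (Finset.mem_range.1 ha))]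

theorem Qterm_I2_le {t : ℝ} (ht : 0 ≤ t) {g : ℝ → ℝ → ℝ → ℝ} (hg : Smooth3 g) (h1 : L2cond t g)
    (h2 : L2condZ t g) {τ : ℝ} (hτ : 0 < τ) (n : ℕ) :
    Qterm t τ g (I2 t g) n ≤ 4 * angT t ^ ((1 : ℝ) / 4) * (τ ^ n * Mfac n *
      ∑ q ∈ Finset.HasAntidiagonal.antidiagonal n, (n.choose q.1 : ℝ) *
        ∑ u ∈ Finset.HasAntidiagonal.antidiagonal q.1,
          ∑ v ∈ Finset.HasAntidiagonal.antidiagonal q.2,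
            transportBound (fun i j => L2w t 1 (i + j) (pdh i j g))
              (fun i j => L2w t 1 (i + j) (pdh i j (pdz g))) u.1 u.2 v.1 v.2) := by
  have hT : 0 ≤ angT t := by unfold angT; linarith
  have hM := (Mfac_pos n).le
  set B := transportBound (fun i j => L2w t 1 (i + j) (pdh i j g))
    (fun i j => L2w t 1 (i + j) (pdh i j (pdz g))) with hBd
  have hB : ∀ i j k l, 0 ≤ B i j k l :=
    transportBound_nonneg (fun _ _ => Real.sqrt_nonneg _) fun _ _ => Real.sqrt_nonneg _
  refine le_trans ?_ (mul_le_mul_of_nonneg_left (mul_le_mul_of_nonneg_left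
    (sum_choose_mul_choose_le hB n) (by positivity)) (by positivity))
  rw [Qterm, ← Finset.Nat.sum_antidiagonal_eq_sum_range_succ
    (fun i j => |I2 t g i j| * τ ^ n * Mfac n / L2w t 1 n (pdh i j g)), Finset.mul_sum,
    Finset.mul_sum]
  refine Finset.sum_le_sum fun p hp => ?_
  have hS : 0 ≤ ∑ r ∈ Finset.HasAntidiagonal.antidiagonal p.1,
      ∑ s ∈ Finset.HasAntidiagonal.antidiagonal p.2,
        (p.1.choose r.1 : ℝ) * (p.2.choose s.1) * B r.1 s.1 r.2 s.2 :=
    Finset.sum_nonneg fun r _ => Finset.sum_nonneg fun s _ =>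
      mul_nonneg (by positivity) (hB _ _ _ _)
  refine div_le_of_le_mul₀ (Real.sqrt_nonneg _) (by positivity) ?_
  have hI := abs_I2_le ht hg h1 h2 p.1 p.2
  rw [Finset.HasAntidiagonal.mem_antidiagonal.1 hp] at hI
  calc _ ≤ _ := mul_le_mul_of_nonneg_right (mul_le_mul_of_nonneg_right hI (by positivity)) hM
    _ = _ := by
      simp only [Finset.mul_sum, Finset.sum_mul]
      exact Finset.sum_congr rfl fun r _ => Finset.sum_congr rfl fun s _ => by rw [hBd]; ring

/-- estimate of the vertical transport term `I₂`. -/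
theorem estimate_I2 (τ₀ : ℝ) (hτ₀ : 0 < τ₀) :
    ∃ C : ℝ, 0 < C ∧
      ∀ t : ℝ, 0 ≤ t → ∀ g : ℝ → ℝ → ℝ → ℝ, DecaySmooth g → L2cond t g → L2condZ t g →
        ∀ τ : ℝ, 0 < τ → τ ≤ τ₀ →
          Summable (Xel t τ g) → Summable (Del t τ g) → Summable (Yel t τ g) →
          ∀ N : ℕ,
            (∑ n ∈ Finset.range N, Qterm t τ g (I2 t g) n) ≤
              C / τ ^ 2 * angT t ^ ((1 : ℝ) / 4) * (Xnrm t τ g + Ynrm t τ g) * Dnrm t τ g := by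
  refine ⟨512 * (1 + τ₀) ^ 3, by positivity, ?_⟩
  intro t ht g hg h1 h2 τ hτ hττ hX hD hY N
  have eX : Xel t τ g = fun n => diag (fun i j => L2w t 1 (i + j) (pdh i j g)) n * τ ^ n *
      Mfac n := funext fun n => by rw [Xel, sum_range_pdh_eq_diag]
  have eY : Yel t τ g = fun n : ℕ => diag (fun i j => L2w t 1 (i + j) (pdh i j g)) n *
      τ ^ (n - 1) * n * Mfac n := funext fun n => by rw [Yel, sum_range_pdh_eq_diag]
  have eD : Del t τ g = fun n => diag (fun i j => L2w t 1 (i + j) (pdh i j (pdz g))) n * τ ^ n *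
      Mfac n := funext fun n => by rw [Del, sum_range_pdh_eq_diag]
  have hT : 0 ≤ angT t := by unfold angT; linarith
  have hM := fun n => (Mfac_pos n).le
  have hnn : ∀ f : ℝ → ℝ → ℝ → ℝ, ∀ n, 0 ≤ diag (fun i j => L2w t 1 (i + j) (pdh i j f)) n :=
    fun f n => diag_nonneg (fun _ _ => Real.sqrt_nonneg _) n
  have hXn : 0 ≤ Xnrm t τ g := tsum_nonneg fun n => by
    rw [eX]; exact mul_nonneg (mul_nonneg (hnn g n) (by positivity)) (hM n)
  have hYn : 0 ≤ Ynrm t τ g := tsum_nonneg fun n => by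
    rw [eY]; exact mul_nonneg (mul_nonneg (mul_nonneg (hnn g n) (by positivity))
      n.cast_nonneg) (hM n)
  have hDn : 0 ≤ Dnrm t τ g := tsum_nonneg fun n => by
    rw [eD]; exact mul_nonneg (mul_nonneg (hnn _ n) (by positivity)) (hM n)
  have hS := sum_weighted_transportBound_le
    (a := fun i j => L2w t 1 (i + j) (pdh i j g))
    (d := fun i j => L2w t 1 (i + j) (pdh i j (pdz g))) (fun _ _ => Real.sqrt_nonneg _)
    (fun _ _ => Real.sqrt_nonneg _) hτ (eX ▸ hX) (eY ▸ hY) (eD ▸ hD) N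
  rw [← eX, ← eY, ← eD] at hS
  calc _ ≤ _ := Finset.sum_le_sum fun n _ => Qterm_I2_le ht hg.1 h1 h2 hτ n
    _ ≤ 4 * angT t ^ ((1 : ℝ) / 4) * (128 * (1 + τ) ^ 3 / τ ^ 2 *
          (Xnrm t τ g + Ynrm t τ g) * Dnrm t τ g) := by
        rw [← Finset.mul_sum]
        exact mul_le_mul_of_nonneg_left hS (by positivity)
    _ = 512 * (1 + τ) ^ 3 / τ ^ 2 * angT t ^ ((1 : ℝ) / 4) *
          (Xnrm t τ g + Ynrm t τ g) * Dnrm t τ g := by ring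
    _ ≤ _ := by gcongr
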